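/- arXiv:0905.1082 — 3 statements merged into one kernel-verified Lean document; each statement's English description precedes it below -/
import Mathlib

section
/- Let k be an infinite field of characteristic p > 2, let m ≥ 2 be an integer, and set b_m = ⌊m/2⌋ + 1. Then CP(G(m)) equals the T-space of k⟨X⟩ generated by the set {[x_1, x_2], [x_1, x_2][x_3, x_4], x_1^p, x_{2b_m−1} · h_{b_m−1}} ∪ {x_{2k+1}^p · w_k : 1 ≤ k ≤ b_m − 1}. -/
noncomputable section

/-- The `i`-th variable `x_i` of the free unital associative algebra `k⟨X⟩`. -/
def xx (k : Type*) [Field k] (i : ℕ) : FreeAlgebra k ℕ := FreeAlgebra.ι k i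

/-- Commutator `[a,b] = ab - ba`. -/
def brk {A : Type*} [Ring A] (a b : A) : A := a * b - b * a

/-- `h_j = ∏_{r=1}^{j} [x_{2r-1}, x_{2r}]`. -/
def hh (k : Type*) [Field k] (j : ℕ) : FreeAlgebra k ℕ :=
  ((List.range j).map (fun r => brk (xx k (2 * r + 1)) (xx k (2 * r + 2)))).prod

/-- `w_n = ∏_{r=1}^{n} [x_{2r-1}, x_{2r}] x_{2r-1}^{p-1} x_{2r}^{p-1}`. -/
def ww (k : Type*) [Field k] (p n : ℕ) : FreeAlgebra k ℕ :=
  ((List.range n).map (fun r =>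
    brk (xx k (2 * r + 1)) (xx k (2 * r + 2)) *
      (xx k (2 * r + 1)) ^ (p - 1) * (xx k (2 * r + 2)) ^ (p - 1))).prod

section CentralCommutators

variable {A : Type*} [Ring A]

/-- The product `[a₁, a₂] [a₃, a₄] ⋯` of the commutators of consecutive entries of a list
(`0` for a list of odd length). -/
def brkProd : List A → A
  | [] => 1
  | [_] => 0
  | a :: b :: L => brk a b * brkProd L

theorem brk_self (a : A) : brk a a = 0 := sub_self _

theorem brk_swap (a b : A) : brk a b = -brk b a := by simp [brk]

theorem map_brk {B F : Type*} [Ring B] [FunLike F A B] [RingHomClass F A B] (f : F) (a b : A) :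
    f (brk a b) = brk (f a) (f b) := by simp [brk]

theorem map_brkProd {B F : Type*} [Ring B] [FunLike F A B] [RingHomClass F A B] (f : F) :
    ∀ L : List A, f (brkProd L) = brkProd (L.map f)
  | [] => map_one f
  | [_] => map_zero f
  | a :: b :: L => by simp [brkProd, map_brk, map_brkProd f L]

theorem brkProd_commute (hc : ∀ a b c : A, Commute (brk a b) c) :
    ∀ (L : List A) (c : A), Commute (brkProd L) c
  | [], c => Commute.one_left c
  | [_], c => Commute.zero_left c
  | a :: b :: L, c => (hc a b c).mul_left (brkProd_commute hc L c)

theorem brk_mul_brk_swap (hc : ∀ a b c : A, Commute (brk a b) c) (a b c d : A) :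
    brk a b * brk c d = -(brk a c * brk b d) := by
  have swap₂ : brk a b * brk c d = -(brk a b * brk d c) := by rw [brk_swap c d]; simp
  have swap₁ : brk a b * brk d c + brk a c * brk d b = 0 := by
    have h := (hc (a * d) c b).eq
    have e : brk (a * d) c = a * brk d c + brk a c * d := by unfold brk; noncomm_ring
    rw [e] at h
    have h1 := (hc d c b).eq
    have h2 := (hc a c b).eq
    have : brk a b * brk d c + brk a c * brk d b =
        ((a * brk d c + brk a c * d) * b - b * (a * brk d c + brk a c * d))
        + a * (b * brk d c - brk d c * b) - (brk a c * b - b * brk a c) * d := by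
      generalize brk d c = P
      generalize brk a c = Q
      unfold brk
      noncomm_ring
    rw [this, h, h1, h2]
    simp
  rw [swap₂, eq_neg_of_add_eq_zero_left swap₁, brk_swap d b]
  simp

theorem brkProd_swap (hc : ∀ a b c : A, Commute (brk a b) c) (a b : A) (L : List A) :
    ∀ M : List A, brkProd (M ++ a :: b :: L) = -brkProd (M ++ b :: a :: L)
  | [] => by simp [brkProd, brk_swap a b]
  | [c] => by
    rcases L with _ | ⟨d, L⟩
    · simp [brkProd]
    · simp only [List.cons_append, List.nil_append, brkProd, ← mul_assoc]
      rw [brk_mul_brk_swap hc, neg_mul]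
  | c :: d :: M => by
    simp only [List.cons_append, brkProd]
    rw [brkProd_swap hc a b L M, mul_neg]

theorem brkProd_perm (hc : ∀ a b c : A, Commute (brk a b) c) {L L' : List A} (h : L.Perm L') :
    brkProd L = brkProd L' ∨ brkProd L = -brkProd L' := by
  suffices H : ∀ M : List A, brkProd (M ++ L) = brkProd (M ++ L') ∨
      brkProd (M ++ L) = -brkProd (M ++ L') from H []
  induction h with
  | nil => exact fun M => Or.inl rfl
  | cons a _ ih => intro M; simpa using ih (M ++ [a])
  | swap a b L => exact fun M => Or.inr (brkProd_swap hc _ _ _ _)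
  | trans _ _ h1 h2 =>
    intro M
    rcases h1 M with h | h <;> rcases h2 M with h' | h' <;> simp [h, h']

theorem brk_pow (hc : ∀ a b c : A, Commute (brk a b) c) (y z : A) (n : ℕ) :
    brk (y ^ (n + 1)) z = (n + 1 : ℕ) • (y ^ n * brk y z) := by
  induction n with
  | zero => simp
  | succ n ih =>
    have e : brk (y ^ (n + 1 + 1)) z = y * brk (y ^ (n + 1)) z + brk y z * y ^ (n + 1) := by
      unfold brk; rw [pow_succ' y (n + 1)]; noncomm_ring
    rw [e, ih, (hc y z _).eq, mul_smul_comm, ← mul_assoc, ← pow_succ', succ_nsmul _ (n + 1)]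

end CentralCommutators

section Spanning

variable {A : Type*} [Ring A]

/-- The monomial `x_{u₁} x_{u₂} ⋯` times the product of commutators `[x_{L₁}, x_{L₂}] ⋯`. -/
def brkTerm (x : ℕ → A) (u L : List ℕ) : A := (u.map x).prod * brkProd (L.map x)

/-- The monomial in the letters of `a - J`, times the product of the commutators of the letters
of `J`, in some fixed order. -/
def normalTerm (x : ℕ → A) (a : Multiset ℕ) (J : Finset ℕ) : A :=
  brkTerm x (a - J.val).toList J.toList

/-- The indices of the normal terms: `i₀` selects, for each multidegree `a` not divisible by `p`,
a letter of multiplicity prime to `p`, which is not allowed to occur in the commutators. -/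
def IsNormalIndex (p l : ℕ) (i₀ : Multiset ℕ → ℕ) (a : Multiset ℕ) (J : Finset ℕ) : Prop :=
  ¬ p ∣ a.count (i₀ a) ∧ i₀ a ∉ J ∧ J.val ≤ a ∧ ∃ j < l, J.card = 2 * j

theorem map_brkTerm {B F : Type*} [Ring B] [FunLike F A B] [RingHomClass F A B] (f : F)
    (x : ℕ → A) (u L : List ℕ) : f (brkTerm x u L) = brkTerm (fun i => f (x i)) u L := by
  simp [brkTerm, map_brkProd, map_list_prod, Function.comp_def]

/-- If every multiplicity in `u ++ L` is divisible by `p`, then the term is, up to reordering,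
a `p`-th power times `∏ x_i ^ (p - 1)` times the commutators. -/
theorem exists_perm_of_dvd_count {p : ℕ} (hp : 0 < p) {u L : List ℕ} (hL : L.Nodup)
    (hd : ∀ i, p ∣ (u ++ L).count i) :
    ∃ v : List ℕ, u.Perm ((List.replicate p v).flatten ++ L.flatMap (List.replicate (p - 1))) := by
  let b : ℕ →₀ ℕ := (Multiset.toFinsupp (u ++ L : Multiset ℕ)).mapRange (· / p) (by simp)
  have hb : ∀ i, b i = (u ++ L).count i / p := fun i => by simp [b]
  let c : ℕ →₀ ℕ := b - Multiset.toFinsupp (L : Multiset ℕ)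
  have hcc : ∀ i, c i = (u ++ L).count i / p - L.count i := fun i => by
    simp [c, hb]
  refine ⟨(Finsupp.toMultiset c).toList, List.perm_iff_count.2 fun i => ?_⟩
  have hv : (Finsupp.toMultiset c).toList.count i = c i := by
    rw [← Multiset.coe_count, Multiset.coe_toList, Finsupp.count_toMultiset]
  have hf : (L.flatMap (List.replicate (p - 1))).count i = (p - 1) * L.count i := by
    clear hL hd hv hcc hb c b
    induction L with
    | nil => simp
    | cons a L ih =>
      rw [List.flatMap_cons, List.count_append, ih, List.count_replicate, List.count_cons]
      split_ifs <;> ring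
  have hr : ∀ n, ((List.replicate n (Finsupp.toMultiset c).toList).flatten).count i = n * c i := by
    intro n
    induction n with
    | zero => simp
    | succ n ih => rw [List.replicate_succ, List.flatten_cons, List.count_append, ih, hv]; ring
  rw [List.count_append, hf, hr, hcc]
  obtain ⟨d, hd⟩ := hd i
  rw [hd, Nat.mul_div_cancel_left _ hp]
  rw [List.count_append] at hd
  have h1 : L.count i ≤ 1 := List.nodup_iff_count_le_one.1 hL i
  obtain ⟨q, rfl⟩ : ∃ q, p = q + 1 := ⟨p - 1, by omega⟩
  rcases Nat.le_one_iff_eq_zero_or_eq_one.1 h1 with h | h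
  · rw [h] at hd ⊢; simpa using hd
  · rw [h] at hd ⊢
    rcases d with _ | d
    · omega
    · simp at hd ⊢; nlinarith

variable {k : Type*} [Field k] [Algebra k A] (hc : ∀ a b c : A, Commute (brk a b) c)
  (x : ℕ → A) (W : Submodule k A)

include hc

theorem brkTerm_perm_right {u L L' : List ℕ} (h : L.Perm L') (hW : brkTerm x u L ∈ W) :
    brkTerm x u L' ∈ W := by
  unfold brkTerm at *
  rcases brkProd_perm hc (h.map x) with e | e <;> rw [e] at hW
  · exact hW
  · simpa using hW

theorem brkTerm_eq_zero_of_not_nodup {u L : List ℕ} (h : ¬ L.Nodup) : brkTerm x u L = 0 := by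
  rw [← List.exists_duplicate_iff_not_nodup] at h
  obtain ⟨i, hi⟩ := h
  obtain ⟨M, hM⟩ : ∃ M, L.Perm (i :: i :: M) := by
    obtain ⟨M, hM⟩ := (List.duplicate_iff_sublist.1 hi).exists_perm_append
    exact ⟨M, by simpa using hM⟩
  have : brkProd ((i :: i :: M).map x) = 0 := by simp [brkProd, brk_self]
  unfold brkTerm
  rcases brkProd_perm hc (hM.map x) with e | e <;> rw [e, this] <;> simp

theorem brkTerm_sub_mem_of_perm {u u' L : List ℕ} (h : u.Perm u')
    (hW : ∀ v a b, brkTerm x v (a :: b :: L) ∈ W) : brkTerm x u L - brkTerm x u' L ∈ W := by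
  suffices H : ∀ v, brkTerm x (v ++ u) L - brkTerm x (v ++ u') L ∈ W from H []
  induction h with
  | nil => intro v; simp
  | cons a _ ih => intro v; simpa using ih (v ++ [a])
  | swap a b u =>
    intro v
    convert hW (v ++ u) b a using 1
    simp only [brkTerm, List.map_append, List.map_cons, List.prod_append, List.prod_cons, brkProd]
    have := (hc (x b) (x a) (u.map x).prod).eq
    calc _ = (v.map x).prod * (brk (x b) (x a) * (u.map x).prod) * brkProd (L.map x) := by
            unfold brk; noncomm_ring
      _ = _ := by rw [this]; noncomm_ring
  | trans _ _ h1 h2 =>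
    intro v
    simpa using add_mem (h1 v) (h2 v)

theorem mul_brk_mul_brkProd_mem {z : ℕ} {L : List ℕ} : ∀ (u v : List ℕ),
    (∀ w q, q ∈ u → (q :: w).Perm (v ++ u) → brkTerm x w (q :: z :: L) ∈ W) →
    (v.map x).prod * brk (u.map x).prod (x z) * brkProd (L.map x) ∈ W
  | [], v, _ => by simp [brk]
  | q :: u, v, H => by
    have h1 := mul_brk_mul_brkProd_mem u (v ++ [q]) fun w r hr hw => H w r (by simp [hr])
      (hw.trans (by simp))
    have h2 := H (v ++ u) q (by simp) List.perm_middle.symm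
    convert add_mem h1 h2 using 1
    simp only [brkTerm, List.map_append, List.map_cons, List.prod_append, List.prod_cons, brkProd,
      List.map_nil, List.prod_nil, mul_one]
    have := (hc (x q) (x z) (u.map x).prod).eq
    calc _ = (v.map x).prod * x q * brk (u.map x).prod (x z) * brkProd (L.map x)
          + (v.map x).prod * (brk (x q) (x z) * (u.map x).prod) * brkProd (L.map x) := by
            unfold brk; noncomm_ring
      _ = _ := by rw [this]; noncomm_ring

theorem brkTerm_mem_of_not_mem {p l : ℕ} {i₀ : Multiset ℕ → ℕ}
    (hN : ∀ a J, IsNormalIndex p l i₀ a J → normalTerm x a J ∈ W) {j : ℕ} (hj : j < l)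
    (hW : ∀ u L, L.length = 2 * (j + 1) → brkTerm x u L ∈ W) {u L : List ℕ}
    (hL : L.length = 2 * j) {a : Multiset ℕ} (ha : a = ↑(u ++ L))
    (ha' : ¬ p ∣ a.count (i₀ a)) (hi : i₀ a ∉ L) : brkTerm x u L ∈ W := by
  by_cases hnd : L.Nodup
  swap
  · rw [brkTerm_eq_zero_of_not_nodup hc x hnd]; exact zero_mem _
  have hval : L.toFinset.val = (L : Multiset ℕ) := by
    rw [List.toFinset_val, hnd.dedup]
  have hLp : L.toFinset.toList.Perm L := List.toFinset_toList hnd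
  have hsub : a - L.toFinset.val = (u : Multiset ℕ) := by
    rw [hval, ha, ← Multiset.coe_add, add_tsub_cancel_right]
  have hup : (a - L.toFinset.val).toList.Perm u := by
    rw [← Multiset.coe_eq_coe, Multiset.coe_toList, hsub]
  have h1 : normalTerm x a L.toFinset ∈ W := by
    refine hN _ _ ⟨ha', by simpa using hi, ?_, j, hj, ?_⟩
    · rw [hval, ha, ← Multiset.coe_add]; exact Multiset.le_add_left _ _
    · rw [List.toFinset_card_of_nodup hnd, hL]
  have h2 := brkTerm_perm_right hc x W hLp h1
  have h3 := brkTerm_sub_mem_of_perm hc x W hup (L := L) fun v b c => hW v _ (by simp [hL]; ring)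
  simpa using sub_mem h2 h3

theorem brkTerm_mem_of_mem {p l : ℕ} [CharP k p] {i₀ : Multiset ℕ → ℕ} (h1 : ∀ a b, brk a b ∈ W)
    (hN : ∀ a J, IsNormalIndex p l i₀ a J → normalTerm x a J ∈ W) {j : ℕ} (hj : j < l)
    (hW : ∀ u L, L.length = 2 * (j + 1) → brkTerm x u L ∈ W) {u L : List ℕ}
    (hL : L.length = 2 * j) {a : Multiset ℕ} (ha : a = ↑(u ++ L))
    (ha' : ¬ p ∣ a.count (i₀ a)) (hi : i₀ a ∈ L) : brkTerm x u L ∈ W := by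
  by_cases hnd : L.Nodup
  swap
  · rw [brkTerm_eq_zero_of_not_nodup hc x hnd]; exact zero_mem _
  set i := i₀ a with hia
  obtain ⟨M, hM⟩ : ∃ M, L.Perm (i :: M) := ⟨_, List.perm_cons_erase hi⟩
  have hMl := hM.length_eq
  rcases M with _ | ⟨z, M⟩
  · simp at hMl; omega
  have hnd' := hM.nodup_iff.1 hnd
  obtain ⟨c, w, hu, hw⟩ : ∃ c w, u.Perm (List.replicate c i ++ w) ∧ i ∉ w := by
    refine ⟨u.count i, u.filter (fun b => !(b == i)), ?_, by simp⟩
    rw [← List.filter_beq]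
    exact (List.filter_append_perm _ _).symm
  have hz : i ≠ z ∧ i ∉ M := by simpa using (List.nodup_cons.1 hnd').1
  have hcount : a.count i = c + 1 := by
    rw [ha, Multiset.coe_count, List.count_append, hu.count_eq, hM.count_eq]
    simp [List.count_append, List.count_eq_zero_of_not_mem hw,
      List.count_eq_zero_of_not_mem hz.2, List.count_cons_of_ne hz.1.symm]
  have hW' : ∀ v b c, brkTerm x v (b :: c :: L) ∈ W := fun v b c => hW v _ (by simp [hL]; ring)
  suffices H : brkTerm x (List.replicate c i ++ w) (i :: z :: M) ∈ W by
    have e := brkTerm_sub_mem_of_perm hc x W hu (L := L) hW'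
    simpa using add_mem e (brkTerm_perm_right hc x W hM.symm H)
  have hbr := h1 (x i ^ (c + 1) * (w.map x).prod) (x z * brkProd (M.map x))
  have hex := mul_brk_mul_brkProd_mem hc x W (z := z) (L := M) w (List.replicate (c + 1) i) (by
    intro v q hq hv
    refine brkTerm_mem_of_not_mem hc x W hN hj hW (a := a) ?_ ?_ ha' ?_
    · simpa [hL] using hMl.symm
    · rw [ha, Multiset.coe_eq_coe, List.perm_iff_count]
      intro r
      have e1 := hv.count_eq r
      have e2 := hu.count_eq r
      have e3 := hM.count_eq r
      simp only [List.count_append, List.count_cons, List.replicate_succ, List.cons_append]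
        at e1 e2 e3 ⊢
      omega
    · rw [← hia]
      simp only [List.mem_cons, not_or]
      exact ⟨fun h => hw (h ▸ hq), hz.1, hz.2⟩)
  have hsum : brk (x i ^ (c + 1) * (w.map x).prod) (x z * brkProd (M.map x)) =
      ((List.replicate (c + 1) i).map x).prod * brk (w.map x).prod (x z) * brkProd (M.map x) +
      (c + 1 : ℕ) • brkTerm x (List.replicate c i ++ w) (i :: z :: M) := by
    have e1 := brk_pow hc (x i) (x z) c
    have e2 := (hc (x i) (x z) (w.map x).prod).eq
    have e3 := (brkProd_commute hc (M.map x) (x i ^ (c + 1) * (w.map x).prod)).eq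
    have e4 : brk (x i ^ (c + 1) * (w.map x).prod) (x z * brkProd (M.map x)) =
        brk (x i ^ (c + 1) * (w.map x).prod) (x z) * brkProd (M.map x) := by
      unfold brk
      rw [mul_assoc (x z), e3]; noncomm_ring
    have e5 : brk (x i ^ (c + 1) * (w.map x).prod) (x z) =
        x i ^ (c + 1) * brk (w.map x).prod (x z) + brk (x i ^ (c + 1)) (x z) * (w.map x).prod := by
      unfold brk; noncomm_ring
    rw [e4, e5, e1]
    simp only [brkTerm, List.map_append, List.map_replicate, List.prod_append, List.prod_replicate,
      List.map_cons, brkProd, add_mul, smul_mul_assoc]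
    rw [mul_assoc (x i ^ c), e2]
    simp only [mul_assoc]
  rw [hsum] at hbr
  have hk := (W.add_mem_iff_right hex).1 hbr
  rw [← Nat.cast_smul_eq_nsmul k] at hk
  refine (W.smul_mem_iff ?_).1 hk
  rw [Ne, CharP.cast_eq_zero_iff k p, ← hcount]
  exact ha'

theorem brkTerm_mem {p l : ℕ} [CharP k p] (hp : 0 < p) {i₀ : Multiset ℕ → ℕ}
    (hi₀ : ∀ a : Multiset ℕ, (∃ i, ¬ p ∣ a.count i) → ¬ p ∣ a.count (i₀ a))
    (h1 : ∀ a b, brk a b ∈ W)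
    (hpow : ∀ (v : A) (L : List A), (∃ j ≤ l, L.length = 2 * j) →
      v ^ p * ((L.map (· ^ (p - 1))).prod * brkProd L) ∈ W)
    (htop : ∀ (v : A) (L : List A), L.length = 2 * l → v * brkProd L ∈ W)
    (hN : ∀ a J, IsNormalIndex p l i₀ a J → normalTerm x a J ∈ W) :
    ∀ j ≤ l, ∀ u L, L.length = 2 * j → brkTerm x u L ∈ W := by
  intro j hj
  induction hj using Nat.decreasingInduction with
  | self => exact fun u L hL => htop _ _ (by simpa using hL)
  | of_succ j hj hW =>
    intro u L hL
    have hW' : ∀ v b c, brkTerm x v (b :: c :: L) ∈ W := fun v b c => hW v _ (by simp [hL]; ring)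
    by_cases hd : ∃ i, ¬ p ∣ (↑(u ++ L) : Multiset ℕ).count i
    · by_cases hi : i₀ ↑(u ++ L) ∈ L
      · exact brkTerm_mem_of_mem hc x W h1 hN hj hW hL rfl (hi₀ _ hd) hi
      · exact brkTerm_mem_of_not_mem hc x W hN hj hW hL rfl (hi₀ _ hd) hi
    · push Not at hd
      by_cases hnd : L.Nodup
      swap
      · rw [brkTerm_eq_zero_of_not_nodup hc x hnd]; exact zero_mem _
      obtain ⟨v, hv⟩ := exists_perm_of_dvd_count hp hnd fun i => by
        simpa only [Multiset.coe_count] using hd i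
      have e := brkTerm_sub_mem_of_perm hc x W hv hW'
      suffices H : brkTerm x ((List.replicate p v).flatten ++ L.flatMap (List.replicate (p - 1))) L
          ∈ W by simpa using add_mem e H
      convert hpow (v.map x).prod (L.map x) ⟨j, hj.le, by simpa using hL⟩ using 1
      rw [brkTerm, List.map_append, List.prod_append, mul_assoc]
      congr 2
      · rw [List.map_flatten, List.map_replicate, List.prod_flatten, List.map_replicate,
          List.prod_replicate]
      · rw [List.map_flatMap, List.flatMap, List.prod_flatten, List.map_map, List.map_map]
        congr 1
        apply List.map_congr_left
        intro i _
        simp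

end Spanning

section Grassmann

open ExteriorAlgebra

variable {k : Type*} [Field k] {M : Type*} [AddCommGroup M] [Module k M]

theorem exteriorAlgebra_mem_center {x : ExteriorAlgebra k M} (h : ∀ v, Commute x (ι k v)) :
    x ∈ Subalgebra.center k (ExteriorAlgebra k M) := by
  rw [Subalgebra.mem_center_iff]
  intro b
  induction b using ExteriorAlgebra.induction with
  | algebraMap r => exact Algebra.commutes r x
  | ι v => exact (h v).symm.eq
  | mul a b ha hb => rw [mul_assoc, hb, ← mul_assoc, ha, mul_assoc]
  | add a b ha hb => rw [add_mul, ha, hb, mul_add]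

theorem ι_mul_ι_swap (v w : M) : ι k v * ι k w = -(ι k w * ι k v) :=
  eq_neg_of_add_eq_zero_left (ι_add_mul_swap v w)

theorem ι_mul_ι_mem_center (v w : M) :
    ι k v * ι k w ∈ Subalgebra.center k (ExteriorAlgebra k M) :=
  exteriorAlgebra_mem_center fun u => by
    rw [Commute, SemiconjBy, mul_assoc, ι_mul_ι_swap w u, mul_neg, ← mul_assoc, ι_mul_ι_swap v u]
    simp [mul_assoc]

variable (k M) in
/-- The span of the products of a vector and a central element of the exterior algebra. -/
def vecMulCenter : Submodule k (ExteriorAlgebra k M) :=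
  LinearMap.range (ι k) * Subalgebra.toSubmodule (Subalgebra.center k (ExteriorAlgebra k M))

theorem vecMulCenter_mul {a b : ExteriorAlgebra k M} (ha : a ∈ vecMulCenter k M)
    (hb : b ∈ vecMulCenter k M) :
    a * b = -(b * a) ∧ a * b ∈ Subalgebra.center k (ExteriorAlgebra k M) := by
  unfold vecMulCenter at ha hb
  induction ha using Submodule.mul_induction_on' with
  | mem_mul_mem v hv y hy =>
    obtain ⟨v, rfl⟩ := hv
    induction hb using Submodule.mul_induction_on' with
    | mem_mul_mem w hw z hz =>
      obtain ⟨w, rfl⟩ := hw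
      rw [Subalgebra.mem_toSubmodule] at hy hz
      have hy' := Subalgebra.mem_center_iff.1 hy
      have hz' := Subalgebra.mem_center_iff.1 hz
      have e : ι k v * y * (ι k w * z) = ι k v * ι k w * (y * z) := by
        rw [mul_assoc, ← mul_assoc y, ← hy' (ι k w)]; simp only [mul_assoc]
      refine ⟨?_, ?_⟩
      · rw [e, ι_mul_ι_swap, neg_mul, mul_assoc _ z, ← mul_assoc z, ← hz' (ι k v), ← hy' z]
        simp only [mul_assoc]
      · rw [e]; exact mul_mem (ι_mul_ι_mem_center v w) (mul_mem hy hz)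
    | add b _ c _ h1 h2 =>
      exact ⟨by rw [mul_add, h1.1, h2.1, add_mul, neg_add], by rw [mul_add]; exact add_mem h1.2 h2.2⟩
  | add a _ c _ h1 h2 =>
    exact ⟨by rw [add_mul, h1.1, h2.1, mul_add, neg_add], by rw [add_mul]; exact add_mem h1.2 h2.2⟩

theorem exists_center_add_vecMulCenter (a : ExteriorAlgebra k M) :
    ∃ z ∈ Subalgebra.center k (ExteriorAlgebra k M), ∃ o ∈ vecMulCenter k M, a = z + o := by
  induction a using CliffordAlgebra.left_induction with
  | algebraMap r => exact ⟨_, Subalgebra.algebraMap_mem _ r, 0, zero_mem _, (add_zero _).symm⟩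
  | add a b ha hb =>
    obtain ⟨z, hz, o, ho, rfl⟩ := ha
    obtain ⟨z', hz', o', ho', rfl⟩ := hb
    exact ⟨_, add_mem hz hz', _, add_mem ho ho', by abel⟩
  | ι_mul a v ha =>
    obtain ⟨z, hz, o, ho, rfl⟩ := ha
    have hv : ι k v ∈ vecMulCenter k M := by
      rw [← mul_one (ι k v)]
      exact Submodule.mul_mem_mul (LinearMap.mem_range_self _ v) (one_mem (Subalgebra.center k _))
    exact ⟨_, (vecMulCenter_mul hv ho).2, _,
      Submodule.mul_mem_mul (LinearMap.mem_range_self _ v) hz, by rw [mul_add, add_comm]⟩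

theorem exists_brk_eq (a b : ExteriorAlgebra k M) : ∃ z ∈ Subalgebra.center k (ExteriorAlgebra k M),
    ∃ o ∈ vecMulCenter k M, ∃ z' ∈ Subalgebra.center k (ExteriorAlgebra k M),
    ∃ o' ∈ vecMulCenter k M, a = z + o ∧ b = z' + o' ∧ brk a b = (2 : k) • (o * o') := by
  obtain ⟨z, hz, o, ho, rfl⟩ := exists_center_add_vecMulCenter a
  obtain ⟨z', hz', o', ho', rfl⟩ := exists_center_add_vecMulCenter b
  refine ⟨z, hz, o, ho, z', hz', o', ho', rfl, rfl, ?_⟩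
  have e := (vecMulCenter_mul ho' ho).1
  have h1 := Subalgebra.mem_center_iff.1 hz
  have h2 := Subalgebra.mem_center_iff.1 hz'
  rw [brk, add_mul, add_mul, mul_add, mul_add, mul_add, mul_add, e, h1 z', h1 o', h2 o, two_smul]
  abel

theorem brk_mem_center (a b : ExteriorAlgebra k M) :
    brk a b ∈ Subalgebra.center k (ExteriorAlgebra k M) := by
  obtain ⟨z, hz, o, ho, z', hz', o', ho', -, -, e⟩ := exists_brk_eq a b
  rw [e]
  exact Subalgebra.smul_mem _ (vecMulCenter_mul ho ho').2 _

theorem exteriorAlgebra_brk_commute (a b c : ExteriorAlgebra k M) : Commute (brk a b) c :=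
  (Subalgebra.mem_center_iff.1 (brk_mem_center a b) c).symm

theorem brkProd_mem_vecMulCenter_pow :
    ∀ L : List (ExteriorAlgebra k M), brkProd L ∈ vecMulCenter k M ^ L.length
  | [] => by simp [brkProd, Submodule.one_eq_range]
  | [_] => zero_mem _
  | a :: b :: L => by
    obtain ⟨z, hz, o, ho, z', hz', o', ho', -, -, e⟩ := exists_brk_eq a b
    rw [brkProd, e, List.length_cons, List.length_cons, pow_succ', pow_succ', ← mul_assoc]
    exact Submodule.mul_mem_mul (Submodule.smul_mem _ _ (Submodule.mul_mem_mul ho ho'))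
      (brkProd_mem_vecMulCenter_pow L)

theorem brkProd_eq_zero [FiniteDimensional k M] {L : List (ExteriorAlgebra k M)}
    (hL : Module.finrank k M < L.length) : brkProd L = 0 := by
  have h := brkProd_mem_vecMulCenter_pow L
  have hcomm : Commute (LinearMap.range (ι k : M →ₗ[k] ExteriorAlgebra k M))
      (Subalgebra.toSubmodule (Subalgebra.center k (ExteriorAlgebra k M))) := by
    apply le_antisymm <;> rw [Submodule.mul_le]
    · intro a ha b hb
      rw [(Subalgebra.mem_center_iff (R := k)).1 hb a]; exact Submodule.mul_mem_mul hb ha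
    · intro a ha b hb
      rw [← (Subalgebra.mem_center_iff (R := k)).1 ha b]; exact Submodule.mul_mem_mul hb ha
  have h0 : LinearMap.range (ι k : M →ₗ[k] ExteriorAlgebra k M) ^ L.length = ⊥ := by
    have := ιMulti_span_fixedDegree k (M := M) L.length
    change ⋀[k]^L.length M = ⊥
    rw [← this, Submodule.span_eq_bot]
    rintro _ ⟨v, rfl⟩
    refine AlternatingMap.map_linearDependent _ _ fun hv => ?_
    have := hv.fintype_card_le_finrank
    simp at this
    omega
  rw [vecMulCenter, hcomm.mul_pow, h0, Submodule.bot_mul] at h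
  simpa using h

variable {p : ℕ} [CharP k p]

theorem vecMulCenter_sq (hp : 2 < p) {o : ExteriorAlgebra k M} (ho : o ∈ vecMulCenter k M) :
    o * o = 0 := by
  have h := (vecMulCenter_mul ho ho).1
  have h2 : (2 : k) ≠ 0 := by
    have := CharP.cast_eq_zero_iff k p 2
    intro h0
    exact absurd (Nat.le_of_dvd two_pos (this.1 (by exact_mod_cast h0))) (by omega)
  have : (2 : k) • (o * o) = 0 := by rw [two_smul]; exact add_eq_zero_iff_eq_neg.2 h
  exact (smul_eq_zero.1 this).resolve_left h2

theorem pow_char_mem_center [Fact p.Prime] (hp : 2 < p) (a : ExteriorAlgebra k M) :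
    a ^ p ∈ Subalgebra.center k (ExteriorAlgebra k M) := by
  obtain ⟨z, hz, o, ho, rfl⟩ := exists_center_add_vecMulCenter a
  have : CharP (ExteriorAlgebra k M) p := charP_of_injective_algebraMap' k p
  have : o ^ p = 0 := by
    obtain ⟨q, rfl⟩ : ∃ q, p = q + 2 := ⟨p - 2, by omega⟩
    rw [pow_add, pow_two, vecMulCenter_sq hp ho, mul_zero]
  rw [add_pow_char_of_commute _ (Subalgebra.mem_center_iff.1 hz o).symm, this, add_zero]
  exact pow_mem hz p

theorem mul_center_add_pow {z o : ExteriorAlgebra k M} (hp : 2 < p)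
    (hz : z ∈ Subalgebra.center k (ExteriorAlgebra k M)) (ho : o ∈ vecMulCenter k M) (n : ℕ) :
    o * (z + o) ^ n = o * z ^ n := by
  induction n with
  | zero => simp
  | succ n ih =>
    have h : z ^ n * o = o * z ^ n := (Subalgebra.mem_center_iff.1 (pow_mem hz n) o).symm
    rw [pow_succ, ← mul_assoc, ih, mul_add, mul_assoc o _ o, h, ← mul_assoc o o,
      vecMulCenter_sq hp ho, zero_mul, add_zero, pow_succ, mul_assoc]

theorem brk_mul_pow_mul_pow_mem_center (hp : 2 < p) (a b : ExteriorAlgebra k M) (n : ℕ) :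
    brk a b * a ^ n * b ^ n ∈ Subalgebra.center k (ExteriorAlgebra k M) := by
  obtain ⟨z, hz, o, ho, z', hz', o', ho', rfl, rfl, e⟩ := exists_brk_eq a b
  have h := Subalgebra.mem_center_iff.1 (pow_mem hz n) o'
  have e1 : o * o' * (z + o) ^ n = o * o' * z ^ n := by
    rw [(vecMulCenter_mul ho ho').1, neg_mul, neg_mul, mul_assoc, mul_center_add_pow hp hz ho,
      mul_assoc]
  have e2 : brk (z + o) (z' + o') * (z + o) ^ n * (z' + o') ^ n =
      (2 : k) • (o * o' * (z ^ n * z' ^ n)) := by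
    rw [e, smul_mul_assoc, smul_mul_assoc, e1, mul_assoc o, h, ← mul_assoc o, mul_assoc (o * z ^ n),
      mul_center_add_pow hp hz' ho', ← mul_assoc, mul_assoc o, ← h]
    simp only [mul_assoc]
  rw [e2]
  exact Subalgebra.smul_mem _ (mul_mem (vecMulCenter_mul ho ho').2
    (mul_mem (pow_mem hz n) (pow_mem hz' n))) _

end Grassmann

section Independence

variable {k : Type*} [Field k]

theorem sum_filter_eq_zero_of_forall_sum_smul_eq_zero [Infinite k] {V I : Type*} [AddCommGroup V]
    [Module k V] (s : Finset I) (deg : I → Multiset ℕ) (v : I → V)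
    (h : ∀ t : ℕ → k, ∑ i ∈ s, ((deg i).map t).prod • v i = 0) (a : Multiset ℕ) :
    ∑ i ∈ s with deg i = a, v i = 0 := by
  classical
  rw [← Module.forall_dual_apply_eq_zero_iff k]
  intro f
  have hP : ∑ i ∈ s, MvPolynomial.monomial (Multiset.toFinsupp (deg i)) (f (v i)) = 0 := by
    apply MvPolynomial.funext
    intro t
    have := congrArg f (h t)
    simp only [map_sum, map_smul, smul_eq_mul, map_zero] at this ⊢
    rw [← this]
    refine Finset.sum_congr rfl fun i _ => ?_
    rw [MvPolynomial.eval_monomial, mul_comm, Finset.prod_multiset_map_count]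
    rfl
  have hc := congrArg (MvPolynomial.coeff (Multiset.toFinsupp a)) hP
  simp only [MvPolynomial.coeff_sum, MvPolynomial.coeff_monomial, MvPolynomial.coeff_zero,
    EmbeddingLike.apply_eq_iff_eq] at hc
  rw [map_sum, Finset.sum_filter]
  exact hc

open ExteriorAlgebra in
theorem exists_prod_ι_mul_ι_ne_zero {m : ℕ} {Q : List ℕ} (hQ : Q.Nodup) (hm : Q.length < m) :
    ∃ (ε : ℕ → Fin m → k) (w : Fin m → k), (∀ i ∉ Q, ε i = 0) ∧
      (Q.map fun i => ι k (ε i)).prod * ι k w ≠ 0 := by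
  let e : Fin (Q.length + 1) → Fin m → k := fun i => Pi.single (Fin.castLE hm i) 1
  have hne : ιMulti k (Q.length + 1) e ≠ 0 := by
    intro h0
    let D : (Fin m → k) [⋀^Fin (Q.length + 1)]→ₗ[k] k :=
      Matrix.detRowAlternating.compLinearMap (LinearMap.funLeft k k (Fin.castLE hm))
    have h1 := liftAlternating_apply_ιMulti
      (fun i => (Pi.single (Q.length + 1) D : ∀ i, (Fin m → k) [⋀^Fin i]→ₗ[k] k) i) e
    rw [h0, map_zero, Pi.single_eq_same] at h1
    have h2 : D e = Matrix.det (1 : Matrix (Fin (Q.length + 1)) (Fin (Q.length + 1)) k) := by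
      change Matrix.det _ = _
      congr 1
      ext i j
      simp [e, LinearMap.funLeft_apply, Pi.single_apply, Matrix.one_apply, eq_comm]
    rw [h2, Matrix.det_one] at h1
    exact zero_ne_one h1
  refine ⟨fun i => if h : i ∈ Q then e ⟨Q.idxOf i, (List.idxOf_lt_length_of_mem h).trans
    (Nat.lt_succ_self _)⟩ else 0, e (Fin.last _), fun i hi => by simp [hi], ?_⟩
  convert hne using 1
  rw [ιMulti_apply, List.ofFn_succ', List.concat_eq_append, List.prod_append, List.prod_singleton]
  congr 2
  apply List.ext_getElem
  · simp
  · intro n h1 h2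
    have h3 : n < Q.length := by simpa using h1
    simp only [List.getElem_map, List.getElem_ofFn, List.getElem_mem, dite_true]
    congr 2
    ext
    simp [hQ.idxOf_getElem]

theorem brkTerm_smul {A : Type*} [Ring A] [Algebra k A] (t : ℕ → k) (y : ℕ → A) (u : List ℕ) :
    ∀ L : List ℕ, brkTerm (fun i => t i • y i) u L = ((u ++ L).map t).prod • brkTerm y u L := by
  have hw : (u.map fun i => t i • y i).prod = (u.map t).prod • (u.map y).prod := by
    induction u with
    | nil => simp
    | cons i u ih => simp only [List.map_cons, List.prod_cons, ih, smul_mul_smul_comm]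
  have hL : ∀ L : List ℕ, brkProd (L.map fun i => t i • y i) =
      (L.map t).prod • brkProd (L.map y) := by
    intro L
    induction L using List.twoStepInduction with
    | nil => simp [brkProd]
    | singleton => simp [brkProd]
    | cons_cons i j L ih _ =>
      simp only [List.map_cons, brkProd, ih, List.prod_cons]
      have : brk (t i • y i) (t j • y j) = (t i * t j) • brk (y i) (y j) := by
        simp only [brk, smul_mul_smul_comm, smul_sub, mul_comm (t j) (t i)]
      rw [this, smul_mul_smul_comm, mul_assoc]
  intro L
  rw [brkTerm, hw, hL, smul_mul_smul_comm, List.map_append, List.prod_append, brkTerm]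

theorem normalTerm_smul {A : Type*} [Ring A] [Algebra k A] (t : ℕ → k) (y : ℕ → A)
    {a : Multiset ℕ} {J : Finset ℕ} (h : J.val ≤ a) :
    normalTerm (fun i => t i • y i) a J = (a.map t).prod • normalTerm y a J := by
  rw [normalTerm, brkTerm_smul, normalTerm]
  congr 1
  rw [← Multiset.prod_coe, ← Multiset.map_coe, ← Multiset.coe_add, Multiset.coe_toList,
    Finset.coe_toList, tsub_add_cancel_of_le h]

variable {M : Type*} [AddCommGroup M] [Module k M] (ε : ℕ → M)

open ExteriorAlgebra

theorem brkProd_map_one_add_ι : ∀ {L : List ℕ}, Even L.length →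
    brkProd (L.map fun i => 1 + ι k (ε i)) =
      (2 : k) ^ (L.length / 2) • (L.map fun i => ι k (ε i)).prod
  | [], _ => by simp [brkProd]
  | [_], h => by simp at h
  | i :: j :: L, h => by
    have h' : Even L.length := by simpa [Nat.even_add_one] using h
    have e : brk (1 + ι k (ε i)) (1 + ι k (ε j)) = (2 : k) • (ι k (ε i) * ι k (ε j)) := by
      have : brk (1 + ι k (ε i)) (1 + ι k (ε j)) =
          ι k (ε i) * ι k (ε j) - ι k (ε j) * ι k (ε i) := by unfold brk; noncomm_ring
      rw [this, ι_mul_ι_swap (ε j), two_smul]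
      abel
    simp only [List.map_cons, brkProd, e, brkProd_map_one_add_ι h', List.prod_cons,
      smul_mul_smul_comm, List.length_cons]
    rw [show (L.length + 1 + 1) / 2 = L.length / 2 + 1 by omega, pow_succ', mul_assoc]

theorem ι_mul_prod_ι_of_mem {L : List ℕ} {i : ℕ} (h : i ∈ L) :
    ι k (ε i) * (L.map fun i => ι k (ε i)).prod = 0 := by
  induction L with
  | nil => simp at h
  | cons j L ih =>
    rw [List.map_cons, List.prod_cons, ← mul_assoc]
    rcases List.mem_cons.1 h with rfl | h
    · rw [ι_sq_zero, zero_mul]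
    · rw [ι_mul_ι_swap, neg_mul, mul_assoc, ih h, mul_zero, neg_zero]

theorem prod_one_add_ι_mul {E : ExteriorAlgebra k M} {i₀ : ℕ}
    (hE : ∀ i ≠ i₀, ι k (ε i) * E = 0) (u : List ℕ) :
    (u.map fun i => 1 + ι k (ε i)).prod * E = E + (u.count i₀ : k) • (ι k (ε i₀) * E) := by
  induction u with
  | nil => simp
  | cons i u ih =>
    rw [List.map_cons, List.prod_cons, mul_assoc, ih]
    have e : ι k (ε i) * (ι k (ε i₀) * E) = 0 := by
      by_cases h : i = i₀
      · rw [h, ← mul_assoc, ι_sq_zero, zero_mul]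
      · rw [← mul_assoc, ι_mul_ι_swap, neg_mul, mul_assoc, hE i h, mul_zero, neg_zero]
    rw [add_mul, one_mul, mul_add, mul_smul_comm, e, smul_zero, add_zero]
    by_cases h : i = i₀
    · subst h
      rw [List.count_cons_self, Nat.cast_add, Nat.cast_one, add_smul, one_smul, add_assoc]
    · rw [hE i h, List.count_cons_of_ne h, add_zero]

theorem eq_zero_of_forall_commute [Infinite k] {p : ℕ} [CharP k p] (hp : 2 < p) {m l : ℕ}
    (hl : 2 * l ≤ m) {i₀ : Multiset ℕ → ℕ} (c : Multiset ℕ × Finset ℕ →₀ k)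
    (hc : ∀ q ∈ c.support, IsNormalIndex p l i₀ q.1 q.2)
    (hcp : ∀ (φ : FreeAlgebra k ℕ →ₐ[k] ExteriorAlgebra k (Fin m → k)) (b),
      Commute (φ (c.sum fun q r => r • normalTerm (xx k) q.1 q.2)) b) : c = 0 := by
  by_contra hne
  obtain ⟨⟨a, J⟩, hq, hmin⟩ := c.support.exists_min_image (fun q => q.2.card)
    (Finsupp.support_nonempty_iff.2 hne)
  obtain ⟨hpa, hi, hJa, j, hj, hJ⟩ := hc _ hq
  simp only at hpa hi hJa hJ
  have hcount : (a - J.val).toList.count (i₀ a) = a.count (i₀ a) := by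
    rw [← Multiset.coe_count, Multiset.coe_toList, Multiset.count_sub,
      Multiset.count_eq_zero_of_notMem (s := J.val) hi, Nat.sub_zero]
  obtain ⟨ε, w, hε, hεw⟩ := exists_prod_ι_mul_ι_ne_zero (k := k) (m := m) (Q := i₀ a :: J.toList)
    (by simp [hi, J.nodup_toList]) (by simp [hJ]; omega)
  let y : ℕ → ExteriorAlgebra k (Fin m → k) := fun i => 1 + ι k (ε i)
  have hsum := sum_filter_eq_zero_of_forall_sum_smul_eq_zero (k := k) c.support Prod.fst
    (fun q => c q • brk (normalTerm y q.1 q.2) (ι k w)) (fun t => by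
      have h := (hcp (FreeAlgebra.lift k fun i => t i • y i) (ι k w)).eq
      rw [← sub_eq_zero] at h
      rw [← h, Finsupp.sum, map_sum, Finset.sum_mul, Finset.mul_sum, ← Finset.sum_sub_distrib]
      refine Finset.sum_congr rfl fun q hq => ?_
      have e : FreeAlgebra.lift k (fun i => t i • y i) (normalTerm (xx k) q.1 q.2) =
          (q.1.map t).prod • normalTerm y q.1 q.2 := by
        rw [normalTerm, map_brkTerm]
        simp only [xx, FreeAlgebra.lift_ι_apply]
        exact normalTerm_smul t y (hc q hq).2.2.1
      rw [map_smul, e, brk, smul_mul_assoc, smul_mul_assoc, mul_smul_comm, mul_smul_comm, smul_sub,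
        smul_sub, smul_comm (c q), smul_comm (c q)]) a
  rw [Finset.sum_eq_single (a, J)] at hsum
  · have hcJ : c (a, J) ≠ 0 := Finsupp.mem_support_iff.1 hq
    have hb := (smul_eq_zero.1 hsum).resolve_left hcJ
    have hlen : J.toList.length = 2 * j := by simpa using hJ
    have hev : Even J.toList.length := hlen ▸ even_two_mul j
    have hE := prod_one_add_ι_mul (k := k) ε (i₀ := i₀ a) (E := brkProd (J.toList.map y)) (by
      intro i hi
      rw [brkProd_map_one_add_ι ε hev, mul_smul_comm]
      by_cases hiJ : i ∈ J.toList
      · rw [ι_mul_prod_ι_of_mem ε hiJ, smul_zero]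
      · rw [hε i (by simp [hi] at hiJ ⊢; exact hiJ)]; simp) (a - J.val).toList
    rw [hcount] at hE
    have hcen := (brkProd_commute exteriorAlgebra_brk_commute (J.toList.map y) (ι k w)).eq
    rw [normalTerm, brkTerm, hE, brk] at hb
    have e : (2 : k) • ((a.count (i₀ a) : k) •
        (ι k (ε (i₀ a)) * brkProd (J.toList.map y) * ι k w)) = 0 := by
      rw [← hb, add_mul, mul_add, ← hcen, add_sub_add_left_eq_sub, smul_mul_assoc, mul_smul_comm,
        ← smul_sub, smul_comm, ← mul_assoc (ι k w), ι_mul_ι_swap w, neg_mul, mul_assoc _ (ι k w),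
        ← hcen, sub_neg_eq_add, two_smul, mul_assoc]
    have h2 : (2 : k) ≠ 0 := by
      intro h0
      have := (CharP.cast_eq_zero_iff k p 2).1 (by exact_mod_cast h0)
      exact absurd (Nat.le_of_dvd two_pos this) (by omega)
    have hca : (a.count (i₀ a) : k) ≠ 0 := by rwa [Ne, CharP.cast_eq_zero_iff k p]
    have e' := (smul_eq_zero.1 ((smul_eq_zero.1 e).resolve_left h2)).resolve_left hca
    rw [brkProd_map_one_add_ι ε hev, mul_smul_comm, smul_mul_assoc] at e'
    exact hεw (by simpa using (smul_eq_zero.1 e').resolve_left (pow_ne_zero _ h2))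
  · rintro ⟨a', J'⟩ hq' hne'
    simp only [Finset.mem_filter] at hq'
    obtain ⟨hq', rfl⟩ := hq'
    obtain ⟨-, hi', -, j', -, hJ'⟩ := hc _ hq'
    simp only at hi' hJ'
    have hex : ∃ i ∈ J', i ∉ J := by
      by_contra! hsub
      exact hne' (by rw [Finset.eq_of_subset_of_card_le hsub (hmin _ hq')])
    obtain ⟨i, hiJ', hiJ⟩ := hex
    have hε0 : ι k (ε i) = 0 := by
      rw [hε i (by
        simp only [List.mem_cons, Finset.mem_toList, not_or]
        exact ⟨fun h => hi' (h ▸ hiJ'), hiJ⟩), map_zero]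
    have h0 : brkProd (J'.toList.map y) = 0 := by
      rw [brkProd_map_one_add_ι ε (by simp [hJ']), List.prod_eq_zero, smul_zero]
      exact List.mem_map.2 ⟨i, by simpa using hiJ', hε0⟩
    simp [normalTerm, brkTerm, h0, brk]
  · intro h
    exact absurd (by simp only [Finset.mem_filter, and_true]; exact hq) h

end Independence

section Generators

variable {A : Type*} [Ring A]

theorem prod_map_brk_eq_brkProd (n : ℕ) (f : ℕ → A) :
    ((List.range n).map fun r => brk (f (2 * r + 1)) (f (2 * r + 2))).prod =
      brkProd ((List.range (2 * n)).map fun i => f (i + 1)) := by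
  induction n generalizing f with
  | zero => simp [brkProd]
  | succ n ih =>
    have := ih (fun i => f (i + 2))
    rw [Nat.mul_succ, List.range_succ_eq_map, List.range_succ_eq_map, List.range_succ_eq_map]
    simp only [List.map_cons, List.map_map, List.prod_cons, brkProd, Function.comp_def]
    congr 1

theorem prod_map_brk_mul_pow (hc : ∀ a b c : A, Commute (brk a b) c) (q n : ℕ) (f : ℕ → A) :
    ((List.range n).map fun r => brk (f (2 * r + 1)) (f (2 * r + 2)) *
      f (2 * r + 1) ^ q * f (2 * r + 2) ^ q).prod =
      (((List.range (2 * n)).map fun i => f (i + 1)).map (· ^ q)).prod *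
        brkProd ((List.range (2 * n)).map fun i => f (i + 1)) := by
  induction n generalizing f with
  | zero => simp [brkProd]
  | succ n ih =>
    have := ih (fun i => f (i + 2))
    rw [Nat.mul_succ, List.range_succ_eq_map, List.range_succ_eq_map, List.range_succ_eq_map]
    simp only [List.map_cons, List.map_map, List.prod_cons, brkProd, Function.comp_def] at this ⊢
    refine (congrArg _ this).trans ?_
    simp only [mul_assoc]
    rw [(hc (f 1) (f 2) _).eq]
    simp only [mul_assoc]
    rw [← (hc (f 1) (f 2) _).eq]

variable (k : Type*) [Field k]

/-- The generators of the T-space of the central polynomials, with all their substitutions. -/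
def centralGens (p l : ℕ) : Set (FreeAlgebra k ℕ) :=
  {y | ∃ ψ : FreeAlgebra k ℕ →ₐ[k] FreeAlgebra k ℕ,
    y = ψ (brk (xx k 1) (xx k 2)) ∨
    y = ψ (brk (xx k 1) (xx k 2) * brk (xx k 3) (xx k 4)) ∨
    y = ψ ((xx k 1) ^ p) ∨
    y = ψ (xx k (2 * (l + 1) - 1) * hh k (l + 1 - 1)) ∨
    ∃ n, 1 ≤ n ∧ n ≤ l + 1 - 1 ∧ y = ψ ((xx k (2 * n + 1)) ^ p * ww k p n)}

variable {k} {p l : ℕ}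

theorem map_hh [Algebra k A] (φ : FreeAlgebra k ℕ →ₐ[k] A) (n : ℕ) :
    φ (hh k n) = brkProd ((List.range (2 * n)).map fun i => φ (xx k (i + 1))) := by
  rw [hh, prod_map_brk_eq_brkProd n (xx k), map_brkProd, List.map_map]
  rfl

theorem centralGens_subset_center [CharP k p] (hp : 2 < p) {M : Type*} [AddCommGroup M] [Module k M]
    [FiniteDimensional k M] (hl : Module.finrank k M < 2 * l + 2)
    (φ : FreeAlgebra k ℕ →ₐ[k] ExteriorAlgebra k M) {f : FreeAlgebra k ℕ}
    (hf : f ∈ Submodule.span k (centralGens k p l)) : φ f ∈ Subalgebra.center k _ := by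
  have : Fact p.Prime := ⟨(CharP.char_is_prime_or_zero k p).resolve_right (by omega)⟩
  suffices H : Submodule.span k (centralGens k p l) ≤
      (Subalgebra.toSubmodule (Subalgebra.center k (ExteriorAlgebra k M))).comap φ.toLinearMap
    from H hf
  rw [Submodule.span_le]
  rintro y ⟨ψ, hy⟩
  change φ y ∈ Subalgebra.center k _
  rcases hy with rfl | rfl | rfl | rfl | ⟨n, -, -, rfl⟩
  · rw [map_brk, map_brk]; exact brk_mem_center _ _
  · rw [map_mul, map_mul, map_brk, map_brk, map_brk, map_brk]
    exact mul_mem (brk_mem_center _ _) (brk_mem_center _ _)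
  · rw [map_pow, map_pow]; exact pow_char_mem_center hp _
  · rw [Nat.add_sub_cancel, map_mul, map_mul, ← AlgHom.comp_apply φ ψ (hh k l), map_hh]
    generalize φ (ψ (xx k _)) = a
    generalize hL : (List.range (2 * l)).map (fun i => (φ.comp ψ) (xx k (i + 1))) = L
    rw [Subalgebra.mem_center_iff]
    intro b
    have h0 : brkProd (b :: a :: L) = 0 :=
      brkProd_eq_zero (by rw [List.length_cons, List.length_cons, ← hL]; simp; omega)
    rw [brkProd, brk, sub_mul, sub_eq_zero] at h0
    rw [mul_assoc a, (brkProd_commute exteriorAlgebra_brk_commute L b).eq, ← mul_assoc, ← mul_assoc,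
      h0]
  · rw [map_mul, map_mul, map_pow, map_pow, ww, map_list_prod, map_list_prod, List.map_map,
      List.map_map]
    refine mul_mem (pow_char_mem_center hp _) (list_prod_mem fun c hc => ?_)
    obtain ⟨r, -, rfl⟩ := List.mem_map.1 hc
    simp only [Function.comp_apply, map_mul, map_brk, map_pow]
    exact brk_mul_pow_mul_pow_mem_center hp _ _ _

section

variable {S : Submodule k (FreeAlgebra k ℕ)} (hS : centralGens k p l ⊆ S)

include hS

theorem brk_mem_of_centralGens (a b : FreeAlgebra k ℕ) : brk a b ∈ S :=
  hS ⟨FreeAlgebra.lift k fun i => if i = 1 then a else b, Or.inl (by simp [xx, map_brk])⟩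

theorem brk_mul_brk_mem_of_centralGens (a b c d : FreeAlgebra k ℕ) : brk a b * brk c d ∈ S :=
  hS ⟨FreeAlgebra.lift k fun i => if i = 1 then a else if i = 2 then b else if i = 3 then c else d,
    Or.inr (Or.inl (by simp [xx, map_brk]))⟩

theorem pow_mem_of_centralGens (a : FreeAlgebra k ℕ) : a ^ p ∈ S :=
  hS ⟨FreeAlgebra.lift k fun _ => a, Or.inr (Or.inr (Or.inl (by simp [xx])))⟩

theorem mul_brkProd_mem_of_centralGens (v : FreeAlgebra k ℕ) {L : List (FreeAlgebra k ℕ)}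
    (hL : L.length = 2 * l) : v * brkProd L ∈ S := by
  refine hS ⟨FreeAlgebra.lift k fun i => if i = 2 * l + 1 then v else L.getD (i - 1) 0,
    Or.inr (Or.inr (Or.inr (Or.inl ?_)))⟩
  rw [map_mul, Nat.add_sub_cancel, map_hh]
  congr 2
  · simp [xx, show 2 * (l + 1) - 1 = 2 * l + 1 by omega]
  · apply List.ext_getElem
    · simp [hL]
    · intro i h1 h2
      have : i ≠ 2 * l := by omega
      simp [xx, this, h1]

theorem exists_pow_mul_ww_mem_of_centralGens (v : FreeAlgebra k ℕ) {L : List (FreeAlgebra k ℕ)}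
    {n : ℕ} (hn : 1 ≤ n) (hnl : n ≤ l) (hL : L.length = 2 * n) :
    ∃ f : ℕ → FreeAlgebra k ℕ, (List.range (2 * n)).map (fun i => f (i + 1)) = L ∧
      v ^ p * ((List.range n).map fun r => brk (f (2 * r + 1)) (f (2 * r + 2)) *
        f (2 * r + 1) ^ (p - 1) * f (2 * r + 2) ^ (p - 1)).prod ∈ S := by
  let f : ℕ → FreeAlgebra k ℕ := fun i => if i = 2 * n + 1 then v else L.getD (i - 1) 0
  refine ⟨f, ?_, hS ⟨FreeAlgebra.lift k f, Or.inr (Or.inr (Or.inr (Or.inr ⟨n, hn, hnl, ?_⟩)))⟩⟩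
  · apply List.ext_getElem
    · simp [hL]
    · intro i h1 h2
      have : i ≠ 2 * n := by omega
      simp [f, this, h2]
  · rw [map_mul, map_pow, ww, map_list_prod, List.map_map]
    congr 2
    · simp [xx, f]
    · simp [Function.comp_def, xx, map_brk]

theorem mul_brk_brk_mul_mem_of_centralGens (a b c u v : FreeAlgebra k ℕ) :
    u * brk (brk a b) c * v ∈ S := by
  have h1 := brk_mem_of_centralGens hS u (brk (brk a b) c * v)
  have h2 := brk_mem_of_centralGens hS (brk a b * (v * u)) c
  have h3 := brk_mul_brk_mem_of_centralGens hS a b (v * u) c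
  convert add_mem h1 (sub_mem h2 h3) using 1
  generalize brk a b = P
  unfold brk
  noncomm_ring

end

theorem span_range_word :
    Submodule.span k (Set.range fun u : List ℕ => (u.map (xx k)).prod) = ⊤ := by
  rw [eq_top_iff]
  rintro f -
  induction f using FreeAlgebra.induction with
  | grade0 r =>
    rw [Algebra.algebraMap_eq_smul_one]
    exact Submodule.smul_mem _ _ (Submodule.subset_span ⟨[], rfl⟩)
  | grade1 i => exact Submodule.subset_span ⟨[i], by simp [xx]⟩
  | mul a b ha hb =>
    have h := Submodule.mul_mem_mul ha hb
    rw [Submodule.span_mul_span] at h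
    refine Submodule.span_mono ?_ h
    rintro _ ⟨_, ⟨u, rfl⟩, _, ⟨v, rfl⟩, rfl⟩
    exact ⟨u ++ v, by simp⟩
  | add a b ha hb => exact add_mem ha hb

/-- The largest two-sided ideal contained in a subspace. -/
def idealCore [Algebra k A] (S : Submodule k A) : Ideal A where
  carrier := {z | ∀ u v, u * z * v ∈ S}
  add_mem' ha hb u v := by rw [mul_add, add_mul]; exact add_mem (ha u v) (hb u v)
  zero_mem' u v := by simp
  smul_mem' c z hz u v := by rw [smul_eq_mul, ← mul_assoc]; exact hz (u * c) v

instance [Algebra k A] (S : Submodule k A) : (idealCore S).IsTwoSided :=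
  ⟨fun c hz u v => by rw [mul_assoc, mul_assoc]; simpa only [mul_assoc] using hz u (c * v)⟩

theorem idealCore_le [Algebra k A] {S : Submodule k A} {z : A} (hz : z ∈ idealCore S) : z ∈ S := by
  simpa using hz 1 1

theorem mem_span_centralGens_sup [CharP k p] (hp : 2 < p) {i₀ : Multiset ℕ → ℕ}
    (hi₀ : ∀ a : Multiset ℕ, (∃ i, ¬ p ∣ a.count i) → ¬ p ∣ a.count (i₀ a)) (f : FreeAlgebra k ℕ) :
    f ∈ Submodule.span k (centralGens k p l) ⊔ Submodule.span k
      ((fun q : Multiset ℕ × Finset ℕ => normalTerm (xx k) q.1 q.2) ''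
        {q | IsNormalIndex p l i₀ q.1 q.2}) := by
  set S := Submodule.span k (centralGens k p l) with hSdef
  set N := Submodule.span k ((fun q : Multiset ℕ × Finset ℕ => normalTerm (xx k) q.1 q.2) ''
        {q | IsNormalIndex p l i₀ q.1 q.2}) with hN
  have hS : centralGens k p l ⊆ S := Submodule.subset_span
  let π := Ideal.Quotient.mkₐ k (idealCore S)
  have hπ : Function.Surjective π := Ideal.Quotient.mkₐ_surjective k _
  have hc : ∀ a b c : FreeAlgebra k ℕ ⧸ idealCore S, Commute (brk a b) c := by
    intro a b c
    obtain ⟨a, rfl⟩ := hπ a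
    obtain ⟨b, rfl⟩ := hπ b
    obtain ⟨c, rfl⟩ := hπ c
    have : π (brk (brk a b) c) = 0 := Ideal.Quotient.eq_zero_iff_mem.2
      fun u v => mul_brk_brk_mul_mem_of_centralGens hS a b c u v
    rw [map_brk, map_brk, brk, sub_eq_zero] at this
    exact this
  let W := (S ⊔ N).map π.toLinearMap
  have hW : ∀ {z}, z ∈ S → π z ∈ W := fun hz => ⟨_, Submodule.mem_sup_left hz, rfl⟩
  have key : ∀ u : List ℕ, π ((u.map (xx k)).prod) ∈ W := by
    intro u
    have h := brkTerm_mem (k := k) (p := p) (l := l) hc (fun i => π (xx k i)) W (by omega) hi₀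
      ?_ ?_ ?_ ?_ 0 (Nat.zero_le _) u [] rfl
    · rw [← map_brkTerm] at h
      simpa [brkTerm, brkProd] using h
    · intro a b
      obtain ⟨a, rfl⟩ := hπ a
      obtain ⟨b, rfl⟩ := hπ b
      rw [← map_brk]
      exact hW (brk_mem_of_centralGens hS a b)
    · rintro v L ⟨j, hj, hL⟩
      obtain ⟨v, rfl⟩ := hπ v
      obtain ⟨L, rfl⟩ := List.map_surjective_iff.2 hπ L
      rcases Nat.eq_zero_or_pos j with rfl | hj0
      · have : L = [] := by simpa using hL
        subst this
        simpa [brkProd] using hW (pow_mem_of_centralGens hS v)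
      · obtain ⟨g, hg, hm⟩ := exists_pow_mul_ww_mem_of_centralGens hS v hj0 hj
          (by simpa using hL : L.length = 2 * j)
        convert hW hm using 1
        rw [map_mul, map_pow, map_list_prod, List.map_map]
        have e := prod_map_brk_mul_pow hc (p - 1) j (fun i => π (g i))
        rw [← hg]
        simp only [List.map_map, Function.comp_def, map_mul, map_brk, map_pow] at e ⊢
        rw [e]
    · intro v L hL
      obtain ⟨v, rfl⟩ := hπ v
      obtain ⟨L, rfl⟩ := List.map_surjective_iff.2 hπ L
      rw [← map_brkProd, ← map_mul]
      exact hW (mul_brkProd_mem_of_centralGens hS v (by simpa using hL))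
    · intro a J haJ
      rw [normalTerm, ← map_brkTerm]
      exact ⟨_, Submodule.mem_sup_right (Submodule.subset_span ⟨(a, J), haJ, rfl⟩), rfl⟩
  have hf : π f ∈ W := by
    have h : f ∈ (⊤ : Submodule k (FreeAlgebra k ℕ)) := trivial
    rw [← span_range_word] at h
    suffices H : Submodule.span k (Set.range fun u : List ℕ => (u.map (xx k)).prod) ≤
      W.comap π.toLinearMap from H h
    rw [Submodule.span_le]
    rintro _ ⟨u, rfl⟩
    exact key u
  obtain ⟨s, hs, hsf⟩ := hf
  have h0 : f - s ∈ idealCore S := Ideal.Quotient.eq_zero_iff_mem.1 (by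
    change π (f - s) = 0
    rw [map_sub, sub_eq_zero]; exact hsf.symm)
  simpa using add_mem (Submodule.mem_sup_left (idealCore_le h0)) hs

end Generators

/-- Let `k` be an infinite field of characteristic `p > 2`, `m ≥ 2`,
`b_m = ⌊m/2⌋ + 1`.  Then `CP(G(m))` equals the T-space of `k⟨X⟩` generated by
`{[x_1,x_2], [x_1,x_2][x_3,x_4], x_1^p, x_{2b_m-1} h_{b_m-1}} ∪
{x_{2k+1}^p w_k : 1 ≤ k ≤ b_m - 1}`. -/
theorem stmt9 (k : Type*) [Field k] [Infinite k] (p : ℕ) [CharP k p] (hp : 2 < p)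
    (m : ℕ) (hm : 2 ≤ m) :
    {f : FreeAlgebra k ℕ |
        ∀ φ : FreeAlgebra k ℕ →ₐ[k] ExteriorAlgebra k (Fin m → k),
          ∀ a, φ f * a = a * φ f} =
    ↑(Submodule.span k {y : FreeAlgebra k ℕ |
        ∃ ψ : FreeAlgebra k ℕ →ₐ[k] FreeAlgebra k ℕ,
          y = ψ (brk (xx k 1) (xx k 2)) ∨
          y = ψ (brk (xx k 1) (xx k 2) * brk (xx k 3) (xx k 4)) ∨
          y = ψ ((xx k 1) ^ p) ∨
          y = ψ (xx k (2 * (m / 2 + 1) - 1) * hh k (m / 2 + 1 - 1)) ∨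
          ∃ n, 1 ≤ n ∧ n ≤ m / 2 + 1 - 1 ∧ y = ψ ((xx k (2 * n + 1)) ^ p * ww k p n)}) := by
  change _ = ((Submodule.span k (centralGens k p (m / 2)) : Submodule k (FreeAlgebra k ℕ)) :
    Set (FreeAlgebra k ℕ))
  have hcen : ∀ {f}, f ∈ Submodule.span k (centralGens k p (m / 2)) →
      ∀ (φ : FreeAlgebra k ℕ →ₐ[k] ExteriorAlgebra k (Fin m → k)) (b), Commute (φ f) b :=
    fun hf φ b => (Subalgebra.mem_center_iff.1
      (centralGens_subset_center hp (by rw [Module.finrank_fin_fun]; omega) φ hf) b).symm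
  refine Set.Subset.antisymm (fun f hf => ?_) fun f hf φ b => hcen hf φ b
  obtain ⟨i₀, hi₀⟩ : ∃ i₀ : Multiset ℕ → ℕ, ∀ a : Multiset ℕ, (∃ i, ¬ p ∣ a.count i) →
      ¬ p ∣ a.count (i₀ a) := by
    have h : ∀ a : Multiset ℕ, ∃ j, (∃ i, ¬ p ∣ a.count i) → ¬ p ∣ a.count j := fun a => by
      by_cases h : ∃ i, ¬ p ∣ a.count i
      · exact ⟨h.choose, fun _ => h.choose_spec⟩
      · exact ⟨0, fun h' => absurd h' h⟩
    choose i₀ hi₀ using h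
    exact ⟨i₀, hi₀⟩
  obtain ⟨s, hs, g, hg, rfl⟩ := Submodule.mem_sup.1
    (mem_span_centralGens_sup (l := m / 2) hp hi₀ f)
  obtain ⟨c, hc, rfl⟩ := (Finsupp.mem_span_image_iff_linearCombination k).1 hg
  have hc0 := eq_zero_of_forall_commute hp (Nat.mul_div_le m 2) c
    (fun q hq => (Finsupp.mem_supported k c).1 hc hq) (fun φ b => by
      have h := (show Commute _ _ from hf φ b).sub_left (hcen hs φ b)
      rw [map_add, add_sub_cancel_left] at h
      exact h)
  rw [hc0, map_zero, add_zero]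
  exact hs

end
end

section
/- Let k be a field of characteristic different from 2 and let m ≥ 1 be an integer. Then the set {z ∈ G_0(m) : z a = a z for all a ∈ G_0(m)} equals the k-linear span of all products e_{i_1}e_{i_2}⋯e_{i_{2r}} with r ≥ 1 and i_1 < ⋯ < i_{2r} ≤ m when m is even, and equals that span plus k·(e_1 e_2 ⋯ e_m) when m is odd. -/
noncomputable section

/-- The `i`-th standard generator (1-indexed, for `1 ≤ i ≤ m`) of the Grassmann
(exterior) algebra `G(m) = ExteriorAlgebra k (Fin m → k)`. -/
def ee (k : Type*) [Field k] (m : ℕ) (i : ℕ) : ExteriorAlgebra k (Fin m → k) :=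
  ExteriorAlgebra.ι k (fun j : Fin m => if (j : ℕ) + 1 = i then 1 else 0)

/-- `G_0(m)`: the nonunitary subalgebra of `G(m)` generated by `e_1, …, e_m`, i.e. the
`k`-span of all increasing products `e_{i_1} ⋯ e_{i_r}` with `r ≥ 1`. -/
def G0 (k : Type*) [Field k] (m : ℕ) : Submodule k (ExteriorAlgebra k (Fin m → k)) :=
  Submodule.span k {u | ∃ r : ℕ, 1 ≤ r ∧ ∃ s : Fin r → ℕ, StrictMono s ∧
    (∀ a, 1 ≤ s a ∧ s a ≤ m) ∧ u = (List.ofFn fun a => ee k m (s a)).prod}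

open ExteriorAlgebra Module

/-- The basis of `G(m)` given by the increasing products `e_{i_1} ⋯ e_{i_r}`,
indexed by the sets `{i_1 < ⋯ < i_r}` (0-indexed). -/
def grassmannBasis (k : Type*) [Field k] (m : ℕ) :
    Basis (Finset (Fin m)) k (ExteriorAlgebra k (Fin m → k)) :=
  (Pi.basisFun k (Fin m)).ExteriorAlgebra

section

variable {k : Type*} [Field k] {m : ℕ}

lemma ee_val_add_one (i : Fin m) : ee k m ((i : ℕ) + 1) = ι k (Pi.basisFun k (Fin m) i) := by
  rw [ee]
  congr 1
  ext j
  simp [Pi.single_apply, Fin.ext_iff]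

lemma grassmannBasis_eq_prod {r : ℕ} (s : Finset (Fin m)) (hs : s.card = r) :
    grassmannBasis k m s =
      (List.ofFn fun a : Fin r => ee k m ((s.orderEmbOfFin hs a : ℕ) + 1)).prod := by
  rw [grassmannBasis, basis_apply_ofCard _ hs, ιMulti_family, ιMulti_apply]
  simp only [ee_val_add_one]
  rfl

lemma setOf_increasing_prod_eq_image (P : ℕ → Prop) :
    {u | ∃ r : ℕ, P r ∧ ∃ s : Fin r → ℕ, StrictMono s ∧
      (∀ a, 1 ≤ s a ∧ s a ≤ m) ∧ u = (List.ofFn fun a => ee k m (s a)).prod} =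
    grassmannBasis k m '' {S | P S.card} := by
  ext u
  constructor
  · rintro ⟨r, hr, s, hs, hsm, rfl⟩
    let f : Fin r → Fin m := fun a => ⟨s a - 1, by have := hsm a; omega⟩
    have hf : StrictMono f := fun a b hab => by
      have h1 := hsm a
      have h2 := hsm b
      have h3 := hs hab
      simp only [f, Fin.mk_lt_mk]
      omega
    have hcard : (Finset.univ.image f).card = r := by
      rw [Finset.card_image_of_injective _ hf.injective, Finset.card_fin]
    refine ⟨Finset.univ.image f, by simpa [hcard] using hr, ?_⟩
    rw [grassmannBasis_eq_prod _ hcard,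
      ← Finset.orderEmbOfFin_unique hcard (fun a => by simp) hf]
    congr 2
    ext a
    have h1 := hsm a
    simp only [f]
    rw [Nat.sub_add_cancel h1.1]
  · rintro ⟨S, hS, rfl⟩
    refine ⟨S.card, hS, fun a => (S.orderEmbOfFin rfl a : ℕ) + 1, fun a b hab => ?_,
      fun a => ⟨Nat.le_add_left 1 _, ?_⟩, grassmannBasis_eq_prod S rfl⟩
    · have : S.orderEmbOfFin rfl a < S.orderEmbOfFin rfl b := by simpa using hab
      simpa using this
    · exact (S.orderEmbOfFin rfl a).isLt

lemma G0_eq_span_image :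
    G0 k m = Submodule.span k (grassmannBasis k m '' {S | 1 ≤ S.card}) := by
  rw [G0, setOf_increasing_prod_eq_image]

lemma span_even_prod_eq_span_image :
    Submodule.span k {u | ∃ r : ℕ, 1 ≤ r ∧ ∃ s : Fin (2 * r) → ℕ,
      StrictMono s ∧ (∀ a, 1 ≤ s a ∧ s a ≤ m) ∧
      u = (List.ofFn fun a => ee k m (s a)).prod} =
    Submodule.span k (grassmannBasis k m '' {S | 1 ≤ S.card ∧ Even S.card}) := by
  rw [← setOf_increasing_prod_eq_image fun r => 1 ≤ r ∧ Even r]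
  congr 1
  ext u
  constructor
  · rintro ⟨r, hr, h⟩
    exact ⟨2 * r, ⟨by omega, even_two_mul r⟩, h⟩
  · rintro ⟨n, ⟨hn, he⟩, h⟩
    obtain ⟨r, rfl⟩ := he.exists_two_nsmul
    exact ⟨r, by rw [smul_eq_mul] at hn; omega, h⟩

lemma grassmannBasis_univ :
    grassmannBasis k m Finset.univ =
      (List.ofFn fun a : Fin m => ee k m ((a : ℕ) + 1)).prod := by
  rw [grassmannBasis_eq_prod _ (Finset.card_fin m),
    ← Finset.orderEmbOfFin_unique (Finset.card_fin m) (f := id) (by simp) strictMono_id]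
  rfl

lemma grassmannBasis_singleton (i : Fin m) :
    grassmannBasis k m {i} = ι k (Pi.basisFun k (Fin m) i) := by
  rw [grassmannBasis_eq_prod _ (Finset.card_singleton i)]
  simp [ee_val_add_one]

lemma ιMulti_mul_ι {R M : Type*} [CommRing R] [AddCommGroup M] [Module R M]
    (v : M) {n : ℕ} (w : Fin n → M) :
    ιMulti R n w * ι R v = (-1) ^ n * (ι R v * ιMulti R n w) := by
  induction n with
  | zero => simp
  | succ n ih =>
    have h : ι R (w 0) * ι R v = -(ι R v * ι R (w 0)) :=
      eq_neg_of_add_eq_zero_left (ι_add_mul_swap _ _)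
    have hc : ι R (w 0) * (-1) ^ n = (-1) ^ n * ι R (w 0) :=
      ((Commute.neg_one_right _).pow_right n).eq
    rw [ιMulti_succ_apply, mul_assoc, ih, ← mul_assoc, hc, mul_assoc, ← mul_assoc (ι R (w 0)),
      h, pow_succ]
    simp [mul_assoc]

lemma grassmannBasis_mul_ι (S : Finset (Fin m)) (v : Fin m → k) :
    grassmannBasis k m S * ι k v = (-1) ^ S.card * (ι k v * grassmannBasis k m S) := by
  rw [grassmannBasis, basis_apply, ιMulti_mul_ι]

lemma commute_grassmannBasis_of_even {S : Finset (Fin m)} (hS : Even S.card)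
    (a : ExteriorAlgebra k (Fin m → k)) : Commute (grassmannBasis k m S) a := by
  induction a using ExteriorAlgebra.induction with
  | algebraMap r => exact Algebra.commute_algebraMap_right _ _
  | ι v => rw [Commute, SemiconjBy, grassmannBasis_mul_ι, hS.neg_one_pow, one_mul]
  | mul a b ha hb => exact ha.mul_right hb
  | add a b ha hb => exact ha.add_right hb

lemma grassmannBasis_mul_of_not_disjoint {S T : Finset (Fin m)} (h : ¬Disjoint S T) :
    grassmannBasis k m S * grassmannBasis k m T = 0 :=
  basis_mul_of_not_disjoint (Pi.basisFun k (Fin m)) (Set.powersetCard.ofCard (s := S) rfl)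
    (Set.powersetCard.ofCard (s := T) rfl) h

lemma grassmannBasis_mul_of_disjoint {S T : Finset (Fin m)} (h : Disjoint S T) :
    ∃ ε : ℤˣ, grassmannBasis k m S * grassmannBasis k m T = ε • grassmannBasis k m (S ∪ T) := by
  have := basis_mul_of_disjoint (Pi.basisFun k (Fin m))
    (Set.powersetCard.ofCard (s := S) rfl) (Set.powersetCard.ofCard (s := T) rfl) h
  exact ⟨_, this.trans (by simp only [← Finset.disjUnion_eq_union _ _ h]; rfl)⟩

lemma repr_singleton_mul_of_ne {S T : Finset (Fin m)} {i : Fin m} (hi : i ∉ T) (h : S ≠ T) :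
    (grassmannBasis k m).repr (grassmannBasis k m {i} * grassmannBasis k m S) (insert i T) = 0 := by
  by_cases hS : i ∈ S
  · rw [grassmannBasis_mul_of_not_disjoint (by simpa using hS)]
    simp
  · obtain ⟨ε, hε⟩ := grassmannBasis_mul_of_disjoint (k := k) (Finset.disjoint_singleton_left.2 hS)
    have hne : insert i S ≠ insert i T := fun he => h <| by
      rw [← Finset.erase_insert hS, ← Finset.erase_insert hi, ← he]
    rcases Int.units_eq_one_or ε with rfl | rfl <;> simp [hε, Finsupp.single_eq_of_ne' hne]

lemma repr_singleton_mul_ne_zero {T : Finset (Fin m)} {i : Fin m} (hi : i ∉ T) :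
    (grassmannBasis k m).repr (grassmannBasis k m {i} * grassmannBasis k m T) (insert i T) ≠ 0 := by
  obtain ⟨ε, hε⟩ := grassmannBasis_mul_of_disjoint (k := k) (Finset.disjoint_singleton_left.2 hi)
  rcases Int.units_eq_one_or ε with rfl | rfl <;> simp [hε]

lemma repr_commutator {T : Finset (Fin m)} {i : Fin m} (hi : i ∉ T) (hT : Odd T.card)
    (z : ExteriorAlgebra k (Fin m → k)) :
    (grassmannBasis k m).repr
        (z * grassmannBasis k m {i} - grassmannBasis k m {i} * z) (insert i T) =
      (grassmannBasis k m).repr z T * (-2 * (grassmannBasis k m).repr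
        (grassmannBasis k m {i} * grassmannBasis k m T) (insert i T)) := by
  let B := grassmannBasis k m
  let f : ExteriorAlgebra k (Fin m → k) →ₗ[k] k :=
    B.coord (insert i T) ∘ₗ (LinearMap.mulRight k (B {i}) - LinearMap.mulLeft k (B {i}))
  let g : ExteriorAlgebra k (Fin m → k) →ₗ[k] k :=
    (LinearMap.mulRight k (-2 * B.repr (B {i} * B T) (insert i T))) ∘ₗ B.coord T
  suffices h : f = g from LinearMap.congr_fun h z
  refine B.ext fun S => ?_
  have hcomm : B S * B {i} = (-1) ^ S.card * (B {i} * B S) := by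
    simp only [B, grassmannBasis_singleton, grassmannBasis_mul_ι]
  simp only [f, g, LinearMap.comp_apply, LinearMap.sub_apply, LinearMap.mulRight_apply,
    LinearMap.mulLeft_apply, Basis.coord_apply, hcomm]
  by_cases hST : S = T
  · subst hST
    rw [hT.neg_one_pow]
    simp
    ring
  · have h0 := repr_singleton_mul_of_ne (k := k) hi hST
    rcases neg_one_pow_eq_or (ExteriorAlgebra k (Fin m → k)) S.card with h | h <;>
      simp [h, B, h0, hST]

lemma repr_eq_zero_of_commute (h2 : (2 : k) ≠ 0) {z : ExteriorAlgebra k (Fin m → k)}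
    (hz : ∀ a ∈ G0 k m, z * a = a * z) {T : Finset (Fin m)} (hT : Odd T.card)
    (hne : T ≠ Finset.univ) : (grassmannBasis k m).repr z T = 0 := by
  obtain ⟨i, hi⟩ : ∃ i, i ∉ T := by
    simpa [Finset.eq_univ_iff_forall] using hne
  have hmem : grassmannBasis k m {i} ∈ G0 k m := by
    rw [G0_eq_span_image]
    exact Submodule.subset_span ⟨{i}, by simp, rfl⟩
  have h := repr_commutator hi hT z
  rw [hz _ hmem, sub_self, map_zero, Finsupp.zero_apply, eq_comm, mul_eq_zero] at h
  exact h.resolve_right (mul_ne_zero (neg_ne_zero.2 h2) (repr_singleton_mul_ne_zero hi))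

/-- The center of `G_0(m)` is spanned by its even basis products and its top-degree product. -/
lemma setOf_commute_eq_span_image (h2 : (2 : k) ≠ 0) :
    {z : ExteriorAlgebra k (Fin m → k) | z ∈ G0 k m ∧ ∀ a ∈ G0 k m, z * a = a * z} =
      (Submodule.span k (grassmannBasis k m ''
        {S | 1 ≤ S.card ∧ (Even S.card ∨ S = Finset.univ)}) : Set _) := by
  ext z
  constructor
  · rintro ⟨hz, hc⟩
    rw [G0_eq_span_image, Basis.mem_span_image] at hz
    refine (Basis.mem_span_image _).2 fun S hS => ⟨hz hS, ?_⟩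
    by_contra! h
    exact Finsupp.mem_support_iff.1 hS
      (repr_eq_zero_of_commute h2 hc (Nat.not_even_iff_odd.1 h.1) h.2)
  · intro hz
    refine ⟨?_, fun a ha => ?_⟩
    · rw [G0_eq_span_image]
      exact Submodule.span_mono (Set.image_mono fun S hS => hS.1) hz
    · rw [G0_eq_span_image] at ha
      refine Submodule.span_induction₂ (p := fun x y _ _ => x * y = y * x) ?_
        (by simp) (by simp) (fun x y w _ _ _ hx hy => by rw [add_mul, mul_add, hx, hy])
        (fun x y w _ _ _ hx hy => by rw [add_mul, mul_add, hx, hy])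
        (fun r x y _ _ h => by simp [h]) (fun r x y _ _ h => by simp [h]) hz ha
      rintro _ _ ⟨S, ⟨hS, hS'⟩, rfl⟩ ⟨T, hT, rfl⟩
      rcases hS' with he | rfl
      · exact commute_grassmannBasis_of_even he _
      · have hne : T ≠ ∅ := (Finset.card_pos.1 hT).ne_empty
        rw [grassmannBasis_mul_of_not_disjoint, grassmannBasis_mul_of_not_disjoint] <;>
          simpa [← Finset.top_eq_univ] using hne

end

/-- For a field `k` of characteristic `≠ 2` and `m ≥ 1`, the set of
elements of `G_0(m)` commuting with all of `G_0(m)` is the span of the even-length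
increasing products of the `e_i` when `m` is even, plus `k·(e_1⋯e_m)` when `m` is odd. -/
theorem stmt10 (k : Type*) [Field k] (hchar : ringChar k ≠ 2) (m : ℕ) (hm : 1 ≤ m)
    (E : Submodule k (ExteriorAlgebra k (Fin m → k)))
    (hE : E = Submodule.span k {u | ∃ r : ℕ, 1 ≤ r ∧ ∃ s : Fin (2 * r) → ℕ,
      StrictMono s ∧ (∀ a, 1 ≤ s a ∧ s a ≤ m) ∧
      u = (List.ofFn fun a => ee k m (s a)).prod}) :
    (Even m →
      {z : ExteriorAlgebra k (Fin m → k) |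
          z ∈ G0 k m ∧ ∀ a ∈ G0 k m, z * a = a * z} = (E : Set _)) ∧
    (¬ Even m →
      {z : ExteriorAlgebra k (Fin m → k) |
          z ∈ G0 k m ∧ ∀ a ∈ G0 k m, z * a = a * z} =
        ((E ⊔ Submodule.span k
            {(List.ofFn fun a : Fin m => ee k m ((a : ℕ) + 1)).prod}) : Submodule k _)) := by
  have h2 : (2 : k) ≠ 0 := Ring.two_ne_zero hchar
  rw [setOf_commute_eq_span_image h2, hE, span_even_prod_eq_span_image]
  refine ⟨fun he => ?_, fun ho => ?_⟩
  · congr 4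
    ext S
    refine ⟨fun h => ⟨h.1, h.2.elim id ?_⟩, fun h => ⟨h.1, Or.inl h.2⟩⟩
    rintro rfl
    simpa using he
  · rw [← grassmannBasis_univ, ← Submodule.span_union, ← Set.image_singleton, ← Set.image_union]
    congr 4
    ext S
    constructor
    · rintro ⟨h, he | hu⟩
      exacts [Or.inl ⟨h, he⟩, Or.inr hu]
    · rintro (⟨h, he⟩ | rfl)
      exacts [⟨h, Or.inl he⟩, ⟨by simpa using hm, Or.inr rfl⟩]

end
end

section
/- Let k be a field of characteristic different from 2 and let m be an odd positive integer. Then for any elements g_1, …, g_{(m+1)/2} of G_0(m) and any a ∈ G_0(m), the element g_1 ∘ g_2 ∘ ⋯ ∘ g_{(m+1)/2} commutes with a. Consequently the polynomial x_1 ∘ x_2 ∘ ⋯ ∘ x_{(m+1)/2} belongs to CP(G_0(m)). -/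
noncomputable section

/-- The left-associated circle product `f 1 ∘ f 2 ∘ ⋯ ∘ f n`, where `x ∘ y = xy + yx`. -/
def circFold {A : Type*} [Ring A] (f : ℕ → A) (n : ℕ) : A :=
  (List.range (n - 1)).foldl (fun acc i => acc * f (i + 2) + f (i + 2) * acc) (f 1)

/-- `F_0`: the two-sided ideal of `k⟨X⟩` generated by the variables. -/
def F0 (k : Type*) [Field k] : Submodule k (FreeAlgebra k ℕ) :=
  Submodule.span k {y | ∃ (a : FreeAlgebra k ℕ) (i : ℕ) (b : FreeAlgebra k ℕ),
    y = a * FreeAlgebra.ι k i * b}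

theorem circFold_one {A : Type*} [Ring A] (f : ℕ → A) : circFold f 1 = f 1 := by
  simp [circFold]

theorem circFold_succ {A : Type*} [Ring A] (f : ℕ → A) (n : ℕ) :
    circFold f (n + 2) = circFold f (n + 1) * f (n + 2) + f (n + 2) * circFold f (n + 1) := by
  simp [circFold, List.range_succ]

theorem map_circFold {A B F : Type*} [Ring A] [Ring B] [FunLike F A B] [RingHomClass F A B]
    (φ : F) (f : ℕ → A) (n : ℕ) :
    φ (circFold f (n + 1)) = circFold (fun i => φ (f i)) (n + 1) := by
  induction n with
  | zero => simp [circFold_one]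
  | succ n ih => simp [circFold_succ, ih]

section FreeAlgebra

variable {k : Type*} [Field k]

theorem mul_mem_F0_left (c : FreeAlgebra k ℕ) {y : FreeAlgebra k ℕ} (hy : y ∈ F0 k) :
    c * y ∈ F0 k := by
  unfold F0 at hy
  induction hy using Submodule.span_induction with
  | mem y hy =>
    obtain ⟨a, i, b, rfl⟩ := hy
    exact Submodule.subset_span ⟨c * a, i, b, by simp only [mul_assoc]⟩
  | zero => simp
  | add y z _ _ h₁ h₂ => rw [mul_add]; exact add_mem h₁ h₂
  | smul r y _ h => rw [mul_smul_comm]; exact Submodule.smul_mem _ _ h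

theorem mul_mem_F0_right (c : FreeAlgebra k ℕ) {y : FreeAlgebra k ℕ} (hy : y ∈ F0 k) :
    y * c ∈ F0 k := by
  unfold F0 at hy
  induction hy using Submodule.span_induction with
  | mem y hy =>
    obtain ⟨a, i, b, rfl⟩ := hy
    exact Submodule.subset_span ⟨a, i, b * c, by simp only [mul_assoc]⟩
  | zero => simp
  | add y z _ _ h₁ h₂ => rw [add_mul]; exact add_mem h₁ h₂
  | smul r y _ h => rw [smul_mul_assoc]; exact Submodule.smul_mem _ _ h

theorem circFold_xx_mem_F0 (n : ℕ) : circFold (xx k) (n + 1) ∈ F0 k := by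
  induction n with
  | zero => exact Submodule.subset_span ⟨1, 1, 1, by simp [circFold_one, xx]⟩
  | succ n ih =>
    rw [circFold_succ]
    exact add_mem (mul_mem_F0_right _ ih) (mul_mem_F0_left _ ih)

end FreeAlgebra

section ParityFiltration

variable {k : Type*} [Field k] {M : Type*} [AddCommGroup M] [Module k M]

theorem ι_mul_eq_neg_one_pow (v : M) {b : ℕ} {y : ExteriorAlgebra k M} (hy : y ∈ ⋀[k]^b M) :
    y * ExteriorAlgebra.ι k v = (-1) ^ b * (ExteriorAlgebra.ι k v * y) := by
  induction hy using Submodule.pow_induction_on_left' with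
  | algebraMap r => simp [Algebra.commutes]
  | add x y i _ _ hx hy => rw [add_mul, hx, hy, mul_add, mul_add]
  | mem_mul m hm i x hx ih =>
    obtain ⟨w, rfl⟩ := hm
    have hswap : ExteriorAlgebra.ι k w * ExteriorAlgebra.ι k v =
        -(ExteriorAlgebra.ι k v * ExteriorAlgebra.ι k w) :=
      eq_neg_of_add_eq_zero_left (ExteriorAlgebra.ι_add_mul_swap w v)
    have hc := (Commute.neg_one_left (ExteriorAlgebra.ι k w)).pow_left i
    rw [mul_assoc, ih, ← mul_assoc, ← hc.eq, mul_assoc, ← mul_assoc (ExteriorAlgebra.ι k w), hswap,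
      pow_succ]
    simp [mul_assoc]

theorem exteriorPower_mul_comm {a b : ℕ} {x y : ExteriorAlgebra k M}
    (hx : x ∈ ⋀[k]^a M) (hy : y ∈ ⋀[k]^b M) : y * x = (-1) ^ (a * b) * (x * y) := by
  induction hx using Submodule.pow_induction_on_left' with
  | algebraMap r => simp [Algebra.commutes]
  | add x z i _ _ hx hz => rw [mul_add, hx, hz, add_mul, mul_add]
  | mem_mul m hm i x hx ih =>
    obtain ⟨w, rfl⟩ := hm
    have hc := (Commute.neg_one_left (ExteriorAlgebra.ι k w)).pow_left (i * b)
    rw [← mul_assoc, ι_mul_eq_neg_one_pow w hy, mul_assoc, mul_assoc, ih,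
      ← mul_assoc (ExteriorAlgebra.ι k w), ← hc.eq, Nat.succ_mul, pow_add,
      ((Commute.refl (-1 : ExteriorAlgebra k M)).pow_pow (i * b) b).eq]
    simp only [mul_assoc]

theorem exteriorPower_eq_bot_of_finrank_lt [FiniteDimensional k M] {n : ℕ}
    (h : Module.finrank k M < n) : (⋀[k]^n M : Submodule k (ExteriorAlgebra k M)) = ⊥ := by
  rw [← ExteriorAlgebra.ιMulti_span_fixedDegree, Submodule.span_eq_bot]
  rintro _ ⟨v, rfl⟩
  refine AlternatingMap.map_linearDependent _ _ fun hv => ?_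
  have := hv.fintype_card_le_finrank
  simp at this
  omega

variable (k M) in
/-- The span of all homogeneous elements of degree `j, j + 2, j + 4, …`. -/
def parityFiltration (j : ℕ) : Submodule k (ExteriorAlgebra k M) :=
  ⨆ i : ℕ, ⋀[k]^(j + 2 * i) M

theorem exteriorPower_le_parityFiltration (j i : ℕ) :
    (⋀[k]^(j + 2 * i) M : Submodule k (ExteriorAlgebra k M)) ≤ parityFiltration k M j :=
  le_iSup (fun i : ℕ => (⋀[k]^(j + 2 * i) M : Submodule k (ExteriorAlgebra k M))) i

theorem mul_mem_parityFiltration {a b : ℕ} {x y : ExteriorAlgebra k M}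
    (hx : x ∈ parityFiltration k M a) (hy : y ∈ parityFiltration k M b) :
    x * y ∈ parityFiltration k M (a + b) := by
  have h : parityFiltration k M a * parityFiltration k M b ≤ parityFiltration k M (a + b) := by
    simp only [parityFiltration, Submodule.iSup_mul, Submodule.mul_iSup]
    refine iSup_le fun i => iSup_le fun j => ?_
    rw [← pow_add, show a + 2 * j + (b + 2 * i) = a + b + 2 * (i + j) by ring]
    exact exteriorPower_le_parityFiltration _ _
  exact h (Submodule.mul_mem_mul hx hy)

theorem parityFiltration_mul_comm {a b : ℕ} {x y : ExteriorAlgebra k M}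
    (hx : x ∈ parityFiltration k M a) (hy : y ∈ parityFiltration k M b) :
    y * x = (-1) ^ (a * b) * (x * y) := by
  unfold parityFiltration at hx hy
  induction hx using Submodule.iSup_induction' with
  | zero => simp
  | add x z _ _ hx hz => rw [mul_add, hx, hz, add_mul, mul_add]
  | mem i x hx =>
    induction hy using Submodule.iSup_induction' with
    | zero => simp
    | add y z _ _ hy hz => rw [add_mul, hy, hz, mul_add, mul_add]
    | mem j y hy =>
      rw [exteriorPower_mul_comm hx hy,
        show (a + 2 * i) * (b + 2 * j) = a * b + 2 * (a * j + i * b + 2 * i * j) by ring,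
        pow_add, pow_mul _ 2]
      simp

theorem parityFiltration_eq_bot_of_finrank_lt [FiniteDimensional k M] {n : ℕ}
    (h : Module.finrank k M < n) : parityFiltration k M n = ⊥ := by
  rw [parityFiltration, iSup_eq_bot]
  exact fun i => exteriorPower_eq_bot_of_finrank_lt (by omega)

theorem circFold_mem_parityFiltration {g : ℕ → ExteriorAlgebra k M}
    (hg : ∀ i, g i ∈ parityFiltration k M 2 ⊔ parityFiltration k M 1) (n : ℕ) :
    circFold g (n + 1) ∈ parityFiltration k M (2 * n + 2) ⊔ parityFiltration k M (2 * n + 1) := by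
  induction n with
  | zero => simpa [circFold_one] using hg 1
  | succ n ih =>
    obtain ⟨A, hA, B, hB, hAB⟩ := Submodule.mem_sup.1 ih
    obtain ⟨u, hu, v, hv, huv⟩ := Submodule.mem_sup.1 (hg (n + 2))
    have hAu := mul_mem_parityFiltration hA hu
    have huA := mul_mem_parityFiltration hu hA
    have hAv := mul_mem_parityFiltration hA hv
    have hvA := mul_mem_parityFiltration hv hA
    have hBu := mul_mem_parityFiltration hB hu
    have huB := mul_mem_parityFiltration hu hB
    have hvB : v * B = -(B * v) := by
      rw [parityFiltration_mul_comm hB hv, Odd.neg_one_pow ⟨n, by ring⟩, neg_one_mul]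
    rw [circFold_succ, ← hAB, ← huv]
    refine Submodule.mem_sup.2 ⟨A * u + u * A, ?_, A * v + v * A + (B * u + u * B), ?_, ?_⟩
    · exact add_mem hAu (by convert huA using 2; ring)
    · exact add_mem (add_mem hAv (by convert hvA using 2; ring))
        (add_mem (by convert hBu using 2; ring) (by convert huB using 2; ring))
    · simp only [add_mul, mul_add, hvB]
      abel

end ParityFiltration

theorem G0_le_parityFiltration (k : Type*) [Field k] (m : ℕ) :
    G0 k m ≤ parityFiltration k (Fin m → k) 2 ⊔ parityFiltration k (Fin m → k) 1 := by
  refine Submodule.span_le.2 ?_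
  rintro _ ⟨r, hr, s, -, -, rfl⟩
  have h : (List.ofFn fun a => ee k m (s a)).prod ∈
      (⋀[k]^r (Fin m → k) : Submodule k (ExteriorAlgebra k (Fin m → k))) := by
    rw [← ExteriorAlgebra.ιMulti_span_fixedDegree]
    refine Submodule.subset_span
      ⟨fun a j => if (j : ℕ) + 1 = s a then 1 else 0, ?_⟩
    rw [ExteriorAlgebra.ιMulti_apply]
    rfl
  obtain ⟨i, hi | hi⟩ : ∃ i, r = 2 + 2 * i ∨ r = 1 + 2 * i := ⟨(r - 1) / 2, by omega⟩
  · exact Submodule.mem_sup_left (exteriorPower_le_parityFiltration 2 i (hi ▸ h))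
  · exact Submodule.mem_sup_right (exteriorPower_le_parityFiltration 1 i (hi ▸ h))

theorem circFold_commute_of_mem_G0 {k : Type*} [Field k] (n : ℕ)
    {g : ℕ → ExteriorAlgebra k (Fin (2 * n + 1) → k)} (hg : ∀ i, g i ∈ G0 k (2 * n + 1))
    {a : ExteriorAlgebra k (Fin (2 * n + 1) → k)} (ha : a ∈ G0 k (2 * n + 1)) :
    circFold g (n + 1) * a = a * circFold g (n + 1) := by
  obtain ⟨A, hA, B, hB, hAB⟩ := Submodule.mem_sup.1
    (circFold_mem_parityFiltration (fun i => G0_le_parityFiltration _ _ (hg i)) n)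
  obtain ⟨u, hu, v, hv, rfl⟩ := Submodule.mem_sup.1 (G0_le_parityFiltration _ _ ha)
  have hzero : ∀ {j : ℕ} {x : ExteriorAlgebra k (Fin (2 * n + 1) → k)}, 2 * n + 1 < j →
      x ∈ parityFiltration k (Fin (2 * n + 1) → k) j → x = 0 := by
    intro j x hj hx
    rwa [parityFiltration_eq_bot_of_finrank_lt (by simpa using hj), Submodule.mem_bot] at hx
  rw [← hAB, hzero (by omega) hA]
  simp only [zero_add, mul_add, add_mul]
  rw [hzero (by omega) (mul_mem_parityFiltration hB hu),
    hzero (by omega) (mul_mem_parityFiltration hB hv),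
    hzero (by omega) (mul_mem_parityFiltration hu hB),
    hzero (by omega) (mul_mem_parityFiltration hv hB)]

/-- Let `k` be a field of characteristic `≠ 2` and `m` odd.  Then for
any `g_1, …, g_{(m+1)/2} ∈ G_0(m)`, the element `g_1 ∘ g_2 ∘ ⋯ ∘ g_{(m+1)/2}` commutes
with every element of `G_0(m)`; consequently `x_1 ∘ ⋯ ∘ x_{(m+1)/2} ∈ CP(G_0(m))`. -/
theorem stmt11 (k : Type*) [Field k] (hchar : ringChar k ≠ 2) (m : ℕ)
    (hm : 1 ≤ m) (hodd : ¬ Even m) :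
    (∀ g : ℕ → ExteriorAlgebra k (Fin m → k), (∀ i, g i ∈ G0 k m) →
      ∀ a ∈ G0 k m,
        circFold g ((m + 1) / 2) * a = a * circFold g ((m + 1) / 2)) ∧
    circFold (xx k) ((m + 1) / 2) ∈
      {f : FreeAlgebra k ℕ | f ∈ F0 k ∧
        ∀ φ : FreeAlgebra k ℕ →ₐ[k] ExteriorAlgebra k (Fin m → k),
          (∀ i, φ (xx k i) ∈ G0 k m) →
          ∀ a ∈ G0 k m, φ f * a = a * φ f} := by
  obtain ⟨n, rfl⟩ := Nat.not_even_iff_odd.1 hodd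
  rw [show (2 * n + 1 + 1) / 2 = n + 1 by omega]
  refine ⟨fun g hg a ha => circFold_commute_of_mem_G0 n hg ha, circFold_xx_mem_F0 n,
    fun φ hφ a ha => ?_⟩
  rw [map_circFold]
  exact circFold_commute_of_mem_G0 n hφ ha
end
end
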